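/- arXiv:1808.01579 — 2 statements merged into one kernel-verified Lean document; each statement's English description precedes it below -/
import Mathlib

section
/- Let F be a field of characteristic not 2. Let A ∈ GL_n(F) and let k ≥ n be an integer such that (−1)^k · det A = 1. Then the matrix A ⊕ (−I_k) ∈ GL_{n+k}(F) (block-diagonal with blocks A and minus the k×k identity) is a product of three U2-matrices of GL_{n+k}(F). -/
namespace UnipotentProducts

open Matrix

section Basic

variable {F : Type*} [Field F]

/-- `P` is a product of two U2-elements. -/
def IsProdTwo {R : Type*} [Ring R] (P : R) : Prop :=
  ∃ a b : R, a * a = 0 ∧ b * b = 0 ∧ P = (1 + a) * (1 + b)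

/-- `P` is a product of three U2-elements. -/
def IsProdThree {R : Type*} [Ring R] (P : R) : Prop :=
  ∃ a b c : R, a * a = 0 ∧ b * b = 0 ∧ c * c = 0 ∧ P = (1 + a) * (1 + b) * (1 + c)

/-- Similarity of square matrices that may be indexed by different types. -/
def Similar {m n : Type*} [Fintype m] [Fintype n] [DecidableEq m] [DecidableEq n]
    (P : Matrix m m F) (Q : Matrix n n F) : Prop :=
  ∃ (S : Matrix m n F) (S' : Matrix n m F), S * S' = 1 ∧ S' * S = 1 ∧ P = S * Q * S'

theorem IsProdTwo.map {R S : Type*} [Ring R] [Ring S] (f : R →+* S) {P : R}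
    (h : IsProdTwo P) : IsProdTwo (f P) := by
  obtain ⟨a, b, ha, hb, rfl⟩ := h
  exact ⟨f a, f b, by rw [← map_mul, ha, map_zero], by rw [← map_mul, hb, map_zero], by simp⟩

theorem IsProdTwo.one {R : Type*} [Ring R] : IsProdTwo (1 : R) := ⟨0, 0, by simp⟩

theorem IsProdTwo.isProdThree_mul {R : Type*} [Ring R] {P a : R} (h : IsProdTwo P)
    (ha : a * a = 0) : IsProdThree ((1 + a) * P) := by
  obtain ⟨b, c, hb, hc, rfl⟩ := h
  exact ⟨a, b, c, ha, hb, hc, by rw [mul_assoc]⟩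

theorem one_add_fromBlocks {m n : Type*} [DecidableEq m] [DecidableEq n] (A : Matrix m m F)
    (B : Matrix m n F) (C : Matrix n m F) (D : Matrix n n F) :
    1 + fromBlocks A B C D = fromBlocks (1 + A) B C (1 + D) := by
  rw [← fromBlocks_one, fromBlocks_add]; simp

theorem fromBlocks_sub_one {m n : Type*} [DecidableEq m] [DecidableEq n] (A : Matrix m m F)
    (B : Matrix m n F) (C : Matrix n m F) (D : Matrix n n F) :
    fromBlocks A B C D - 1 = fromBlocks (A - 1) B C (D - 1) := by
  rw [sub_eq_add_neg, ← fromBlocks_one, fromBlocks_neg, fromBlocks_add]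
  simp [sub_eq_add_neg]

theorem one_sub_fromBlocks {m n : Type*} [DecidableEq m] [DecidableEq n] (A : Matrix m m F)
    (B : Matrix m n F) (C : Matrix n m F) (D : Matrix n n F) :
    1 - fromBlocks A B C D = fromBlocks (1 - A) (-B) (-C) (1 - D) := by
  rw [← neg_sub, fromBlocks_sub_one, fromBlocks_neg, neg_sub, neg_sub]

variable {l m n o : Type*} [Fintype l] [Fintype m] [Fintype n] [Fintype o]
  [DecidableEq l] [DecidableEq m] [DecidableEq n] [DecidableEq o]

theorem Similar.refl (P : Matrix m m F) : Similar P P := ⟨1, 1, by simp⟩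

theorem Similar.symm {P : Matrix m m F} {Q : Matrix n n F} (h : Similar P Q) : Similar Q P := by
  obtain ⟨S, S', h1, h2, rfl⟩ := h
  refine ⟨S', S, h2, h1, ?_⟩
  rw [show S' * (S * Q * S') * S = (S' * S) * Q * (S' * S) by simp only [Matrix.mul_assoc], h2]
  simp

theorem Similar.trans {P : Matrix l l F} {Q : Matrix m m F} {R : Matrix n n F}
    (h : Similar P Q) (h' : Similar Q R) : Similar P R := by
  obtain ⟨S, S', h1, h2, rfl⟩ := h
  obtain ⟨T, T', h3, h4, rfl⟩ := h'
  refine ⟨S * T, T' * S', ?_, ?_, by simp only [Matrix.mul_assoc]⟩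
  · rw [show S * T * (T' * S') = S * (T * T') * S' by simp only [Matrix.mul_assoc], h3,
      Matrix.mul_one, h1]
  · rw [show T' * S' * (S * T) = T' * (S' * S) * T by simp only [Matrix.mul_assoc], h2,
      Matrix.mul_one, h4]

theorem Similar.of_mul_eq {P Q T : Matrix m m F} (hT : IsUnit T) (h : P * T = T * Q) :
    Similar P Q := by
  obtain ⟨u, rfl⟩ := hT
  exact ⟨u, ↑u⁻¹, u.mul_inv, u.inv_mul, by rw [← h, Matrix.mul_assoc, u.mul_inv, Matrix.mul_one]⟩

theorem Similar.of_submatrix (e : m ≃ n) {P : Matrix m m F} {Q : Matrix n n F}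
    (h : P = Q.submatrix e e) : Similar P Q := by
  refine ⟨(1 : Matrix n n F).submatrix e id, (1 : Matrix n n F).submatrix id e, ?_, ?_, ?_⟩
  · rw [← Matrix.submatrix_mul _ _ _ _ _ Function.bijective_id]; simp
  · rw [← Matrix.submatrix_mul _ _ _ _ _ e.bijective]; simp
  · rw [h]; ext i j; simp [Matrix.mul_apply, Matrix.one_apply]

theorem Similar.neg {P : Matrix m m F} {Q : Matrix n n F} (h : Similar P Q) :
    Similar (-P) (-Q) := by
  obtain ⟨S, S', h1, h2, rfl⟩ := h
  exact ⟨S, S', h1, h2, by simp⟩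

theorem Similar.fromBlocks {P : Matrix l l F} {Q : Matrix m m F} {P' : Matrix n n F}
    {Q' : Matrix o o F} (h : Similar P Q) (h' : Similar P' Q') :
    Similar (fromBlocks P 0 0 P') (fromBlocks Q 0 0 Q') := by
  obtain ⟨S, S', h1, h2, rfl⟩ := h
  obtain ⟨T, T', h3, h4, rfl⟩ := h'
  exact ⟨Matrix.fromBlocks S 0 0 T, Matrix.fromBlocks S' 0 0 T', by simp [fromBlocks_multiply, *],
    by simp [fromBlocks_multiply, *], by simp [fromBlocks_multiply]⟩

theorem Similar.det_eq {P : Matrix m m F} {Q : Matrix n n F} (h : Similar P Q) :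
    P.det = Q.det := by
  obtain ⟨S, S', h1, h2, rfl⟩ := h
  exact Matrix.det_conj_of_mul_eq_one h1 h2

theorem IsProdThree.of_similar {P : Matrix m m F} {Q : Matrix n n F} (h : Similar P Q)
    (hQ : IsProdThree Q) : IsProdThree P := by
  obtain ⟨S, S', h1, h2, rfl⟩ := h
  obtain ⟨a, b, c, ha, hb, hc, rfl⟩ := hQ
  have key : ∀ x y : Matrix n n F, (S * x * S') * (S * y * S') = S * (x * y) * S' := by
    intro x y
    rw [show S * x * S' * (S * y * S') = S * x * (S' * S) * y * S' by simp only [Matrix.mul_assoc],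
      h2]
    simp only [Matrix.mul_assoc, Matrix.mul_one]
  have key' : ∀ x : Matrix n n F, 1 + S * x * S' = S * (1 + x) * S' := by
    intro x; rw [Matrix.mul_add, Matrix.add_mul, Matrix.mul_one, h1]
  refine ⟨S * a * S', S * b * S', S * c * S', ?_, ?_, ?_, ?_⟩ <;>
    simp [key, key', ha, hb, hc]

theorem IsProdTwo.of_similar {P : Matrix m m F} {Q : Matrix n n F} (h : Similar P Q)
    (hQ : IsProdTwo Q) : IsProdTwo P := by
  obtain ⟨S, S', h1, h2, rfl⟩ := h
  obtain ⟨a, b, ha, hb, rfl⟩ := hQ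
  have key : ∀ x y : Matrix n n F, (S * x * S') * (S * y * S') = S * (x * y) * S' := by
    intro x y
    rw [show S * x * S' * (S * y * S') = S * x * (S' * S) * y * S' by simp only [Matrix.mul_assoc],
      h2]
    simp only [Matrix.mul_assoc, Matrix.mul_one]
  have key' : ∀ x : Matrix n n F, 1 + S * x * S' = S * (1 + x) * S' := by
    intro x; rw [Matrix.mul_add, Matrix.add_mul, Matrix.mul_one, h1]
  refine ⟨S * a * S', S * b * S', ?_, ?_, ?_⟩ <;>
    simp [key, key', ha, hb]

theorem IsProdTwo.fromBlocks {P : Matrix m m F} {Q : Matrix n n F} (hP : IsProdTwo P)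
    (hQ : IsProdTwo Q) : IsProdTwo (fromBlocks P 0 0 Q) := by
  obtain ⟨a, b, ha, hb, rfl⟩ := hP
  obtain ⟨a', b', ha', hb', rfl⟩ := hQ
  exact ⟨Matrix.fromBlocks a 0 0 a', Matrix.fromBlocks b 0 0 b', by simp [fromBlocks_multiply, *],
    by simp [fromBlocks_multiply, *], by simp [fromBlocks_multiply, one_add_fromBlocks]⟩

theorem IsProdThree.fromBlocks {P : Matrix m m F} {Q : Matrix n n F} (hP : IsProdThree P)
    (hQ : IsProdThree Q) : IsProdThree (fromBlocks P 0 0 Q) := by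
  obtain ⟨a, b, c, ha, hb, hc, rfl⟩ := hP
  obtain ⟨a', b', c', ha', hb', hc', rfl⟩ := hQ
  exact ⟨Matrix.fromBlocks a 0 0 a', Matrix.fromBlocks b 0 0 b', Matrix.fromBlocks c 0 0 c',
    by simp [fromBlocks_multiply, *], by simp [fromBlocks_multiply, *],
    by simp [fromBlocks_multiply, *], by simp [fromBlocks_multiply, one_add_fromBlocks]⟩

theorem isUnit_fromBlocks_upper {A : Matrix m m F} {D : Matrix n n F} (hA : IsUnit A)
    (hD : IsUnit D) (B : Matrix m n F) : IsUnit (fromBlocks A B 0 D) := by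
  rw [Matrix.isUnit_iff_isUnit_det] at *
  rw [det_fromBlocks_zero₂₁]; exact hA.mul hD

theorem isUnit_fromBlocks_lower {A : Matrix m m F} {D : Matrix n n F} (hA : IsUnit A)
    (hD : IsUnit D) (C : Matrix n m F) : IsUnit (fromBlocks A 0 C D) := by
  rw [Matrix.isUnit_iff_isUnit_det] at *
  rw [det_fromBlocks_zero₁₂]; exact hA.mul hD

/-- A block-triangular matrix whose diagonal blocks satisfy `N ^ 2 = 0`, where `1 + N` is the first
block, and `R - 1` invertible, is similar to its block-diagonal part. -/
theorem similar_diag_of_isUnit_sub_one {N : Matrix m m F} {R : Matrix n n F} (H : Matrix m n F)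
    (hN : N * N = 0) (hR : IsUnit (R - 1)) :
    Similar (fromBlocks (1 + N) H 0 R) (fromBlocks (1 + N) 0 0 R) := by
  obtain ⟨u, hu⟩ := hR
  obtain ⟨S, hS⟩ : ∃ S : Matrix n n F, S * (R - 1) = 1 := ⟨↑u⁻¹, by rw [← hu, u.inv_mul]⟩
  have hSR : S * R = 1 + S := by
    rw [Matrix.mul_sub, Matrix.mul_one] at hS
    rw [← hS]; abel
  -- `Z` solves the Sylvester equation `(1 + N) * Z + H = Z * R`
  set Z : Matrix m n F := H * S + N * H * S * S with hZ
  refine Similar.of_mul_eq (T := Matrix.fromBlocks 1 Z 0 1)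
    (isUnit_fromBlocks_upper isUnit_one isUnit_one _) ?_
  have : (1 + N) * Z + H = Z * R := by
    rw [hZ]
    have e1 : H * S * R = H + H * S := by
      rw [Matrix.mul_assoc, hSR, Matrix.mul_add, Matrix.mul_one]
    have e2 : N * H * S * S * R = N * H * S + N * H * S * S := by
      rw [Matrix.mul_assoc, hSR, Matrix.mul_add, Matrix.mul_one]
    have e3 : N * (N * H * S * S) = 0 := by
      simp only [← Matrix.mul_assoc, hN, Matrix.zero_mul]
    rw [Matrix.add_mul _ _ R, e1, e2, Matrix.add_mul, Matrix.mul_add N, e3, Matrix.one_mul]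
    simp only [← Matrix.mul_assoc]; abel
  simp [fromBlocks_multiply, this]

theorem isNilpotent_fromBlocks_upper {A : Matrix m m F} {D : Matrix n n F} (hA : IsNilpotent A)
    (hD : IsNilpotent D) (B : Matrix m n F) : IsNilpotent (fromBlocks A B 0 D) := by
  obtain ⟨p, hp⟩ := hA
  obtain ⟨q, hq⟩ := hD
  have key : ∀ k : ℕ, ∃ C,
      (Matrix.fromBlocks A B 0 D) ^ k = Matrix.fromBlocks (A ^ k) C 0 (D ^ k) := by
    intro k
    induction k with
    | zero => exact ⟨0, by simp⟩
    | succ k ih =>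
      obtain ⟨C, hC⟩ := ih
      exact ⟨A ^ k * B + C * D, by rw [pow_succ, hC]; simp [fromBlocks_multiply, pow_succ]⟩
  obtain ⟨C, hC⟩ := key (p + q)
  refine ⟨(p + q) * 2, ?_⟩
  rw [pow_mul, hC, pow_add, hp, pow_add, hq, sq]
  simp [fromBlocks_multiply]

theorem isNilpotent_fromBlocks_lower {A : Matrix m m F} {D : Matrix n n F} (hA : IsNilpotent A)
    (hD : IsNilpotent D) (C : Matrix n m F) : IsNilpotent (fromBlocks A 0 C D) := by
  have h := isNilpotent_fromBlocks_upper
    (Matrix.isNilpotent_transpose_iff.2 hA) (Matrix.isNilpotent_transpose_iff.2 hD) Cᵀ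
  rw [← Matrix.isNilpotent_transpose_iff, fromBlocks_transpose]
  simpa using h

end Basic

section Unipotent

variable {F : Type*} [Field F] {V : Type*} [AddCommGroup V] [Module F V]

theorem exists_extension_inf_eq {X K Y : Submodule F V} (hX : X ≤ Y) (hK : K ≤ Y) :
    ∃ Z, X ≤ Z ∧ Z ≤ Y ∧ Z ⊓ K = X ⊓ K ∧ Z ⊔ K = Y := by
  obtain ⟨C, hC⟩ := exists_isCompl (X ⊔ K)
  refine ⟨X ⊔ C ⊓ Y, le_sup_left, sup_le hX inf_le_right, ?_, ?_⟩
  · apply le_antisymm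
    · refine le_inf ?_ inf_le_right
      rintro z ⟨hz, hzK⟩
      obtain ⟨x, hx, c, hc, rfl⟩ := Submodule.mem_sup.1 hz
      have : c ∈ (X ⊔ K) ⊓ C := by
        refine ⟨?_, hc.1⟩
        have := Submodule.sub_mem _ ((le_sup_right : K ≤ X ⊔ K) hzK) ((le_sup_left : X ≤ X ⊔ K) hx)
        simpa using this
      rw [hC.inf_eq_bot, Submodule.mem_bot] at this
      subst this; simpa using hx
    · exact inf_le_inf_right _ le_sup_left
  · rw [sup_right_comm, ← sup_inf_assoc_of_le C (sup_le hX hK), hC.sup_eq_top, top_inf_eq]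

/-- A pair of complementary subspaces exchanged by `N` and `Q * N`, where `N` is nilpotent and `Q`
is the inverse of `1 + N`, exists inside every range of a power of `N`. -/
theorem exists_exchanged_pair {N Q : Module.End F V} (hQ : Q * (1 + N) = 1) (hQ' : (1 + N) * Q = 1)
    {p : ℕ} (hN : N ^ p = 0) (i : ℕ) :
    ∃ A B : Submodule F V, A ⊓ B = ⊥ ∧ A ⊔ B = LinearMap.range (N ^ (p - i)) ∧
      B ≤ A.comap N ∧ A ≤ B.comap (Q * N) := by
  have hQa : ∀ x, Q (x + N x) = x := fun x => by simpa using LinearMap.congr_fun hQ x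
  have hQb : ∀ x, Q x + N (Q x) = x := fun x => by simpa using LinearMap.congr_fun hQ' x
  induction i with
  | zero => exact ⟨⊥, ⊥, by simp [hN]⟩
  | succ i ih =>
    obtain ⟨A, B, hAB, hAB', hB, hA⟩ := ih
    rcases Nat.lt_or_ge i p with hi | hi
    swap
    · refine ⟨A, B, hAB, ?_, hB, hA⟩
      rwa [show p - (i + 1) = p - i by omega]
    rw [show p - i = (p - (i + 1)) + 1 by omega] at hAB'
    set j := p - (i + 1)
    set S := LinearMap.range (N ^ j) with hS
    have hmem : ∀ x ∈ A ⊔ B, ∃ y ∈ S, N y = x := by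
      intro x hx
      rw [hAB', pow_succ'] at hx
      obtain ⟨y, rfl⟩ := hx
      exact ⟨(N ^ j) y, ⟨y, rfl⟩, rfl⟩
    have hmem' : ∀ x ∈ S, N x ∈ A ⊔ B := by
      rintro _ ⟨y, rfl⟩
      rw [hAB', pow_succ']
      exact ⟨y, rfl⟩
    have hle : A ⊔ B ≤ S := by
      rw [hAB', pow_succ]; exact LinearMap.range_comp_le_range _ _
    set Ap := S ⊓ B.comap (Q * N) with hAp
    set Bp := S ⊓ A.comap N with hBp
    set K := LinearMap.ker N ⊓ S with hK
    have hinf : Ap ⊓ Bp ≤ K := by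
      rintro x ⟨⟨hxS, hx1⟩, ⟨-, hx2⟩⟩
      refine ⟨?_, hxS⟩
      have h1 : Q (N x) ∈ B := hx1
      have h2 : N (Q (N x)) ∈ A := hB h1
      have h3 : Q (N x) ∈ A ⊓ B := by
        refine ⟨?_, h1⟩
        have h4 : N x - N (Q (N x)) ∈ A := A.sub_mem hx2 h2
        rwa [show N x - N (Q (N x)) = Q (N x) by rw [sub_eq_iff_eq_add]; exact (hQb _).symm] at h4
      rw [hAB, Submodule.mem_bot] at h3
      have := hQb (N x)
      rw [h3] at this
      simpa using this.symm
    have hsup : S ≤ Ap ⊔ Bp := by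
      intro x hx
      obtain ⟨a, ha, b, hb, hab⟩ := Submodule.mem_sup.1 (hmem' x hx)
      have h1 : a - N b ∈ A := A.sub_mem ha (hB hb)
      obtain ⟨y, hy, hy'⟩ := hmem _ ((le_sup_left : A ≤ A ⊔ B) h1)
      refine Submodule.mem_sup.2 ⟨x - y, ⟨S.sub_mem hx hy, ?_⟩, y, ⟨hy, ?_⟩, by simp⟩
      · change Q (N (x - y)) ∈ B
        rw [map_sub, hy', ← hab, show a + b - (a - N b) = b + N b by abel, hQa]
        exact hb
      · change N y ∈ A
        rwa [hy']
    have hKA : K ≤ Ap := fun x hx => ⟨hx.2, by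
      have h : N x = 0 := hx.1
      simp [h]⟩
    have hKB : K ≤ Bp := fun x hx => ⟨hx.2, by
      have h : N x = 0 := hx.1
      simp [h]⟩
    have hAA : A ≤ Ap := le_inf (le_sup_left.trans hle) hA
    have hBB : B ≤ Bp := le_inf (le_sup_right.trans hle) hB
    obtain ⟨K₀, -, hK₀, hK₀inf, hK₀sup⟩ := exists_extension_inf_eq (X := (⊥ : Submodule F V))
      (K := A ⊓ K ⊔ B ⊓ K) (Y := K) bot_le (sup_le inf_le_right inf_le_right)
    obtain ⟨A₁, hA₁, hA₁', hA₁inf, hA₁sup⟩ := exists_extension_inf_eq (X := A ⊔ K₀) (K := K)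
      (sup_le hAA (hK₀.trans hKA)) hKA
    obtain ⟨B₁, hB₁, hB₁', hB₁inf, hB₁sup⟩ := exists_extension_inf_eq hBB hKB
    have hK_le : K ≤ A₁ ⊔ B₁ := by
      rw [← hK₀sup]
      refine sup_le (le_sup_of_le_left (le_sup_right.trans hA₁)) (sup_le ?_ ?_)
      · exact le_sup_of_le_left (inf_le_left.trans (le_sup_left.trans hA₁))
      · exact le_sup_of_le_right (inf_le_left.trans hB₁)
    refine ⟨A₁, B₁, ?_, ?_, ?_, ?_⟩
    · have h1 : A₁ ⊓ B₁ ≤ (A ⊔ K₀) ⊓ K ⊓ (B ⊓ K) := by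
        rw [← hA₁inf, ← hB₁inf]
        have : A₁ ⊓ B₁ ≤ K := (inf_le_inf hA₁' hB₁').trans hinf
        exact le_inf (le_inf inf_le_left this) (le_inf inf_le_right this)
      rw [eq_bot_iff]
      refine h1.trans ?_
      rintro x ⟨⟨hx1, hx2⟩, hx3⟩
      obtain ⟨a, ha, c, hc, rfl⟩ := Submodule.mem_sup.1 hx1
      have haK : a ∈ K := by simpa using K.sub_mem hx2 (hK₀ hc)
      have h2 : c ∈ K₀ ⊓ (A ⊓ K ⊔ B ⊓ K) := by
        refine ⟨hc, ?_⟩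
        have := Submodule.sub_mem _ ((le_sup_right : B ⊓ K ≤ A ⊓ K ⊔ B ⊓ K) hx3)
          ((le_sup_left : A ⊓ K ≤ A ⊓ K ⊔ B ⊓ K) ⟨ha, haK⟩)
        simpa using this
      rw [hK₀inf] at h2
      simp only [bot_inf_eq, Submodule.mem_bot] at h2
      subst h2
      rw [← hAB]
      exact ⟨by simpa using ha, by simpa using hx3.1⟩
    · apply le_antisymm
      · exact sup_le (hA₁'.trans inf_le_left) (hB₁'.trans inf_le_left)
      · refine hsup.trans (sup_le ?_ ?_)
        · rw [← hA₁sup]; exact sup_le le_sup_left hK_le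
        · rw [← hB₁sup]; exact sup_le le_sup_right hK_le
    · exact hB₁'.trans (inf_le_right.trans (Submodule.comap_mono (le_sup_left.trans hA₁)))
    · exact hA₁'.trans (inf_le_right.trans (Submodule.comap_mono hB₁))

theorem isProdTwo_one_add_of_isNilpotent_end {N : Module.End F V} (hN : IsNilpotent N) :
    IsProdTwo (1 + N) := by
  obtain ⟨u, hu⟩ := hN.isUnit_one_add
  obtain ⟨p, hp⟩ := hN
  have h1 : (↑u⁻¹ : Module.End F V) * (1 + N) = 1 := by rw [← hu, u.inv_mul]
  have h2 : (1 + N) * (↑u⁻¹ : Module.End F V) = 1 := by rw [← hu, u.mul_inv]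
  set Q : Module.End F V := ↑u⁻¹
  obtain ⟨A, B, hAB, hAB', hB, hA⟩ := exists_exchanged_pair h1 h2 hp p
  rw [Nat.sub_self, pow_zero, Module.End.one_eq_id, LinearMap.range_id] at hAB'
  have hc : IsCompl A B := ⟨disjoint_iff.2 hAB, codisjoint_iff.2 hAB'⟩
  set π : Module.End F V := A.projection B hc with hπ
  have hπA : ∀ x ∈ A, π x = x := fun x hx => Submodule.projection_apply_of_mem_left hc hx
  have hπB : ∀ x ∈ B, π x = 0 := fun x hx => Submodule.projection_apply_of_mem_right hc hx
  have hmA : ∀ x, π x ∈ A := fun x => Submodule.projection_apply_mem hc x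
  have hmB : ∀ x, x - π x ∈ B := fun x => Submodule.sub_projection_mem hc x
  have hQN : ∀ x, Q (N x) + N (Q (N x)) = N x := fun x => by
    simpa using LinearMap.congr_fun h2 (N x)
  have hNB : ∀ x ∈ B, N x ∈ A := fun x hx => hB hx
  have hNA : ∀ x ∈ A, Q (N x) ∈ B := fun x hx => hA hx
  refine ⟨N * (1 - π), Q * N * π, ?_, ?_, ?_⟩
  · ext x
    have := hNB _ (hmB x)
    simp only [Module.End.mul_apply, LinearMap.sub_apply, Module.End.one_apply,
      LinearMap.zero_apply]
    rw [hπA _ this, sub_self, map_zero]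
  · ext x
    have := hNA _ (hmA x)
    simp only [Module.End.mul_apply, LinearMap.zero_apply]
    rw [hπB _ this, map_zero, map_zero]
  · ext x
    have h3 := hπB _ (hNA _ (hmA x))
    have h4 := hQN (π x)
    simp only [Module.End.mul_apply, LinearMap.add_apply, Module.End.one_apply,
      LinearMap.sub_apply, map_add, map_sub, h3, sub_zero]
    rw [h4]
    abel

theorem isProdTwo_of_isNilpotent_sub_one {n : Type*} [Fintype n] [DecidableEq n]
    {P : Matrix n n F} (hP : IsNilpotent (P - 1)) : IsProdTwo P := by
  have h := isProdTwo_one_add_of_isNilpotent_end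
    (hP.map (Matrix.toLinAlgEquiv' : Matrix n n F ≃ₐ[F] _))
  have h' := h.map
    ((Matrix.toLinAlgEquiv' : Matrix n n F ≃ₐ[F] _).symm : _ →+* Matrix n n F)
  simpa using h'

end Unipotent

section TwoFactors

variable {F : Type*} [Field F] {m n : Type*} [Fintype m] [Fintype n]
  [DecidableEq m] [DecidableEq n]

theorem isProdTwo_companion (B : Matrix m m F) :
    IsProdTwo (fromBlocks 0 (-1) 1 B : Matrix (m ⊕ m) (m ⊕ m) F) := by
  have hT : IsUnit (fromBlocks (-1) 1 1 0 : Matrix (m ⊕ m) (m ⊕ m) F) :=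
    IsUnit.of_mul_eq_one (fromBlocks 0 1 1 1) (by simp [fromBlocks_multiply])
  refine IsProdTwo.of_similar
    (Similar.of_mul_eq (Q := fromBlocks (1 + (B - 2)) 1 (B - 2) 1) hT ?_) ?_
  · simp only [fromBlocks_multiply]
    congr 1 <;> noncomm_ring
  · refine ⟨fromBlocks 0 1 0 0, fromBlocks 0 0 (B - 2) 0, by simp [fromBlocks_multiply],
      by simp [fromBlocks_multiply], ?_⟩
    simp [fromBlocks_multiply, one_add_fromBlocks]

/-- A matrix similar to a companion-type block matrix is a product of two U2-matrices. -/
theorem isProdTwo_of_mul_eq_mul_companion {P T : Matrix (m ⊕ m) (m ⊕ m) F} (B : Matrix m m F)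
    (hT : IsUnit T) (h : P * T = T * fromBlocks 0 (-1) 1 B) : IsProdTwo P :=
  (isProdTwo_companion B).of_similar (Similar.of_mul_eq hT h)

theorem isProdTwo_neg_fromBlocks_one {J : Matrix m m F} (hJ : IsUnit J) :
    IsProdTwo (-(fromBlocks 1 J 0 1 : Matrix (m ⊕ m) (m ⊕ m) F)) := by
  obtain ⟨u, rfl⟩ := hJ
  refine isProdTwo_of_mul_eq_mul_companion (T := fromBlocks 0 (-u) 1 (-1)) (-2)
    (IsUnit.of_mul_eq_one (fromBlocks (-↑u⁻¹) 1 (-↑u⁻¹) 0) (by simp [fromBlocks_multiply])) ?_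
  rw [fromBlocks_neg]
  simp only [fromBlocks_multiply]
  congr 1 <;> noncomm_ring

theorem isProdTwo_fromBlocks_inverse {D D' : Matrix m m F} (h : D * D' = 1) (h' : D' * D = 1)
    (hD : IsUnit (D - D')) : IsProdTwo (fromBlocks D' 0 0 D : Matrix (m ⊕ m) (m ⊕ m) F) := by
  refine isProdTwo_of_mul_eq_mul_companion (T := fromBlocks 1 D' 1 D) (D + D') ?_ ?_
  · have : (fromBlocks 1 D' 1 D : Matrix (m ⊕ m) (m ⊕ m) F)
        = (fromBlocks 1 0 1 1 : Matrix (m ⊕ m) (m ⊕ m) F) * fromBlocks 1 D' 0 (D - D') := by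
      simp [fromBlocks_multiply]
    rw [this]
    exact (isUnit_fromBlocks_lower (A := (1 : Matrix m m F)) isUnit_one isUnit_one 1).mul
      (isUnit_fromBlocks_upper (A := (1 : Matrix m m F)) isUnit_one hD D')
  · simp only [fromBlocks_multiply]
    congr 1 <;> simp [Matrix.mul_add, h, h']

theorem isUnit_sub_one_of_isNilpotent_add_one (h2 : (2 : F) ≠ 0) {R : Matrix n n F}
    (hR : IsNilpotent (R + 1)) : IsUnit (R - 1) := by
  have h2' : IsUnit (-2 : Matrix n n F) := by
    refine IsUnit.of_mul_eq_one (-((2 : F)⁻¹ • 1)) ?_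
    rw [neg_mul_neg, Matrix.mul_smul, Matrix.mul_one,
      show (2 : Matrix n n F) = (2 : F) • 1 by rw [two_smul]; norm_num, smul_smul,
      inv_mul_cancel₀ h2, one_smul]
  have := hR.isUnit_add_left_of_commute h2' (Commute.ofNat_right (R + 1) 2).neg_right
  rwa [show -2 + (R + 1) = R - 1 by rw [← one_add_one_eq_two]; abel] at this

theorem isProdTwo_neg_of_isNilpotent {R : Matrix n n F} (hR : IsNilpotent (R + 1)) :
    IsProdTwo (-R) := by
  have := hR.neg
  rw [neg_add, ← sub_eq_add_neg] at this
  exact isProdTwo_of_isNilpotent_sub_one this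

theorem isProdTwo_neg_fromBlocks {J : Matrix m m F} (hJ : IsUnit J) (H : Matrix (m ⊕ m) n F)
    {R : Matrix n n F} (hu : IsUnit (R - 1)) (hR : IsProdTwo (-R)) :
    IsProdTwo (-(fromBlocks (fromBlocks 1 J 0 1 : Matrix (m ⊕ m) (m ⊕ m) F) H 0 R)) := by
  have hN : (fromBlocks 1 J 0 1 : Matrix (m ⊕ m) (m ⊕ m) F) = 1 + fromBlocks 0 J 0 0 := by
    rw [one_add_fromBlocks]; simp
  have hs : Similar (fromBlocks (fromBlocks 1 J 0 1 : Matrix (m ⊕ m) (m ⊕ m) F) H 0 R)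
      (fromBlocks (fromBlocks 1 J 0 1) 0 0 R) := by
    rw [hN]
    exact similar_diag_of_isUnit_sub_one H (by simp [fromBlocks_multiply]) hu
  refine IsProdTwo.of_similar hs.neg ?_
  rw [fromBlocks_neg, neg_zero, neg_zero]
  exact (isProdTwo_neg_fromBlocks_one hJ).fromBlocks hR

end TwoFactors

section Reduction

variable {F : Type*} [Field F] {d n : Type*} [Fintype d] [Fintype n]
  [DecidableEq d] [DecidableEq n]

/-- Left multiplication by a transvection-like U2-matrix and a unipotent conjugation turn
`-(1 ⊕ 1 ⊕ G)` into a matrix with freely chosen parameters `φ` and `C`. -/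
theorem isProdThree_of_isProdTwo_shift {G C : Matrix n n F} {φ : Matrix d n F}
    (Λ₁ : Matrix d n F) (Λ₂ : Matrix n n F) (hφ : φ = Λ₁ * (G - 1)) (hC : C = Λ₂ * (G - 1))
    (h : IsProdTwo (-(fromBlocks 1 (fromCols 0 φ) 0 (fromBlocks 1 C (-1) (G - C)) :
      Matrix (d ⊕ (n ⊕ n)) (d ⊕ (n ⊕ n)) F))) :
    IsProdThree (-(fromBlocks 1 0 0 (fromBlocks 1 0 0 G) :
      Matrix (d ⊕ (n ⊕ n)) (d ⊕ (n ⊕ n)) F)) := by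
  set a : Matrix (d ⊕ (n ⊕ n)) (d ⊕ (n ⊕ n)) F := fromBlocks 0 0 0 (fromBlocks 0 0 1 0) with ha
  have h3 := h.isProdThree_mul (a := a) (by simp [ha, fromBlocks_multiply])
  have e1 : (1 + a) * -(fromBlocks 1 (fromCols 0 φ) 0 (fromBlocks 1 C (-1) (G - C)) :
      Matrix (d ⊕ (n ⊕ n)) (d ⊕ (n ⊕ n)) F)
      = -(fromBlocks 1 (fromCols 0 φ) 0 (fromBlocks 1 C 0 G)) := by
    rw [ha, one_add_fromBlocks, one_add_fromBlocks, Matrix.mul_neg]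
    simp [fromBlocks_multiply]
  rw [e1] at h3
  refine IsProdThree.of_similar (Similar.neg (Similar.symm ?_)) h3
  refine Similar.of_mul_eq (T := fromBlocks 1 (fromCols 0 Λ₁) 0 (fromBlocks 1 Λ₂ 0 1))
    (isUnit_fromBlocks_upper isUnit_one (isUnit_fromBlocks_upper isUnit_one isUnit_one _) _) ?_
  rw [hφ, hC]
  simp [fromBlocks_multiply, fromCols_mul_fromBlocks, Matrix.mul_sub]
  ext i (j | j) <;> simp

/-- The reduction adapted to a factorization `G = X * Y`. -/
theorem isProdThree_of_factorization {X Y : Matrix n n F} {φ : Matrix d n F}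
    (Λ₁ : Matrix d n F) (Λ₂ : Matrix n n F) (hφ : φ = Λ₁ * (X * Y - 1))
    (hC : (1 - X) * (1 - Y) = Λ₂ * (X * Y - 1))
    (h : IsProdTwo (-(fromBlocks 1 (fromCols φ 0) 0 (fromBlocks Y (-1) 0 X) :
      Matrix (d ⊕ (n ⊕ n)) (d ⊕ (n ⊕ n)) F))) :
    IsProdThree (-(fromBlocks 1 0 0 (fromBlocks 1 0 0 (X * Y)) :
      Matrix (d ⊕ (n ⊕ n)) (d ⊕ (n ⊕ n)) F)) := by
  refine isProdThree_of_isProdTwo_shift Λ₁ Λ₂ hφ hC (IsProdTwo.of_similar (Similar.neg ?_) h)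
  have hT : IsUnit (fromBlocks (X - 1) 1 1 0 : Matrix (n ⊕ n) (n ⊕ n) F) :=
    IsUnit.of_mul_eq_one (fromBlocks 0 1 1 (1 - X)) (by simp [fromBlocks_multiply])
  refine Similar.of_mul_eq (T := fromBlocks 1 0 0 (fromBlocks (X - 1) 1 1 0))
    (isUnit_fromBlocks_upper isUnit_one hT _) ?_
  simp only [fromBlocks_multiply, fromCols_mul_fromBlocks, Matrix.mul_zero, Matrix.zero_mul,
    Matrix.mul_one, Matrix.one_mul, add_zero, zero_add]
  congr 2 <;> noncomm_ring

end Reduction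

section Decomposable

variable {F : Type*} [Field F] {w d r : Type*} [Fintype w] [Fintype d] [Fintype r]
  [DecidableEq w] [DecidableEq d] [DecidableEq r]

/-- Regrouping of the indices that collects the eigenvalue `1` of the reduced matrix in the first
two blocks. -/
def regroupEquiv (w d r : Type*) :
    d ⊕ ((w ⊕ (d ⊕ r)) ⊕ (w ⊕ (d ⊕ r))) ≃ ((w ⊕ d) ⊕ (w ⊕ d)) ⊕ (r ⊕ (d ⊕ r)) where
  toFun
    | .inl i => .inl (.inl (.inr i))
    | .inr (.inl (.inl i)) => .inl (.inl (.inl i))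
    | .inr (.inl (.inr (.inl i))) => .inl (.inr (.inr i))
    | .inr (.inl (.inr (.inr i))) => .inr (.inl i)
    | .inr (.inr (.inl i)) => .inl (.inr (.inl i))
    | .inr (.inr (.inr i)) => .inr (.inr i)
  invFun
    | .inl (.inl (.inr i)) => .inl i
    | .inl (.inl (.inl i)) => .inr (.inl (.inl i))
    | .inl (.inr (.inr i)) => .inr (.inl (.inr (.inl i)))
    | .inr (.inl i) => .inr (.inl (.inr (.inr i)))
    | .inl (.inr (.inl i)) => .inr (.inr (.inl i))
    | .inr (.inr i) => .inr (.inr (.inr i))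
  left_inv := by rintro (i | ((i | (i | i)) | (i | i))) <;> rfl
  right_inv := by rintro (((i | i) | (i | i)) | (i | i)) <;> rfl

theorem isProdThree_of_isProdTwo_remainder {H : Matrix w (d ⊕ r) F}
    {X Y₂ : Matrix (d ⊕ r) (d ⊕ r) F} {y : Matrix d r F} {Y : Matrix r r F}
    (hX : IsUnit (X - 1)) (hY : IsUnit (Y - 1)) (hY₂ : Y₂ = fromBlocks 1 y 0 Y)
    (hR : IsProdTwo (-(fromBlocks Y (fromCols 0 (-1)) 0 X :
      Matrix (r ⊕ (d ⊕ r)) (r ⊕ (d ⊕ r)) F)))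
    (L₁ : Matrix (d ⊕ r) w F) (L₂ : Matrix (d ⊕ r) (d ⊕ r) F)
    (hL : L₁ * H + L₂ * (X * Y₂ - 1) = 1) :
    IsProdThree (-(fromBlocks 1 0 0 (fromBlocks 1 0 0 (fromBlocks 1 H 0 (X * Y₂))) :
      Matrix (d ⊕ ((w ⊕ (d ⊕ r)) ⊕ (w ⊕ (d ⊕ r)))) (d ⊕ ((w ⊕ (d ⊕ r)) ⊕ (w ⊕ (d ⊕ r)))) F)) := by
  set X' : Matrix (w ⊕ (d ⊕ r)) (w ⊕ (d ⊕ r)) F := fromBlocks 1 0 0 X with hX'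
  set Y' : Matrix (w ⊕ (d ⊕ r)) (w ⊕ (d ⊕ r)) F := fromBlocks 1 H 0 Y₂ with hY'
  have hXY : fromBlocks 1 H 0 (X * Y₂) = X' * Y' := by simp [hX', hY', fromBlocks_multiply]
  set L : Matrix (w ⊕ (d ⊕ r)) (w ⊕ (d ⊕ r)) F := fromBlocks 0 0 L₁ L₂ with hL'
  have hLG : L * (X' * Y' - 1) = fromBlocks 0 0 0 1 := by
    rw [← hXY, fromBlocks_sub_one]
    simp [hL', fromBlocks_multiply, hL]
  set φ : Matrix d (w ⊕ (d ⊕ r)) F := fromCols 0 (fromCols 1 0) with hφ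
  rw [hXY]
  refine isProdThree_of_factorization (φ := φ) (φ * L) (fromBlocks 0 0 0 ((1 - X) * (1 - Y₂)) * L)
    ?_ ?_ ?_
  · rw [Matrix.mul_assoc, hLG, hφ, fromCols_mul_fromBlocks]; simp
  · rw [Matrix.mul_assoc, hLG, hX', hY', one_sub_fromBlocks, one_sub_fromBlocks]
    simp [fromBlocks_multiply]
  · set P : Matrix (d ⊕ ((w ⊕ (d ⊕ r)) ⊕ (w ⊕ (d ⊕ r))))
        (d ⊕ ((w ⊕ (d ⊕ r)) ⊕ (w ⊕ (d ⊕ r)))) F :=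
      fromBlocks 1 (fromCols φ 0) 0 (fromBlocks Y' (-1) 0 X') with hP
    set J : Matrix (w ⊕ d) (w ⊕ d) F := fromBlocks (-1) H.toCols₁ 0 1 with hJ
    set e := regroupEquiv w d r with he
    have hs : Similar P (fromBlocks (fromBlocks 1 J 0 1)
        (P.submatrix e.symm e.symm).toBlocks₁₂ 0 (fromBlocks Y (fromCols 0 (-1)) 0 X)) := by
      refine Similar.of_submatrix e ?_
      rw [← Matrix.submatrix_id_id P, ← e.symm_comp_self, ← Matrix.submatrix_submatrix]
      congr 1
      ext (((i | i) | (i | i)) | (i | (i | i))) (((j | j) | (j | j)) | (j | (j | j))) <;>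
        simp [he, regroupEquiv, hP, hφ, hX', hY', hY₂, hJ, Matrix.one_apply, toBlocks₁₂,
          Sum.inl_injective.eq_iff]
    refine IsProdTwo.of_similar hs.neg (isProdTwo_neg_fromBlocks ?_ _ ?_ hR)
    · exact isUnit_fromBlocks_upper (A := (-1 : Matrix w w F)) isUnit_one.neg isUnit_one _
    · rw [fromBlocks_sub_one]
      exact isUnit_fromBlocks_upper hY hX _

theorem isProdThree_of_isNilpotent (h2 : (2 : F) ≠ 0) {H : Matrix w (d ⊕ r) F}
    {X Y₂ : Matrix (d ⊕ r) (d ⊕ r) F} {y : Matrix d r F} {Y : Matrix r r F}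
    (hX : IsNilpotent (X + 1)) (hY : IsNilpotent (Y + 1)) (hY₂ : Y₂ = fromBlocks 1 y 0 Y)
    (L₁ : Matrix (d ⊕ r) w F) (L₂ : Matrix (d ⊕ r) (d ⊕ r) F)
    (hL : L₁ * H + L₂ * (X * Y₂ - 1) = 1) :
    IsProdThree (-(fromBlocks 1 0 0 (fromBlocks 1 0 0 (fromBlocks 1 H 0 (X * Y₂))) :
      Matrix (d ⊕ ((w ⊕ (d ⊕ r)) ⊕ (w ⊕ (d ⊕ r)))) (d ⊕ ((w ⊕ (d ⊕ r)) ⊕ (w ⊕ (d ⊕ r)))) F)) := by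
  refine isProdThree_of_isProdTwo_remainder (isUnit_sub_one_of_isNilpotent_add_one h2 hX)
    (isUnit_sub_one_of_isNilpotent_add_one h2 hY) hY₂ (isProdTwo_neg_of_isNilpotent ?_) L₁ L₂ hL
  rw [add_comm, one_add_fromBlocks, add_comm 1 X, add_comm 1 Y]
  exact isNilpotent_fromBlocks_upper hY hX _

end Decomposable

section KernelBasis

variable {F : Type*} [Field F] {n : Type*} [Fintype n] [DecidableEq n]

theorem exists_mul_eq_one_of_mulVec_injective {m s : Type*} [Fintype m] [DecidableEq m]
    [Fintype s] [DecidableEq s] {K : Matrix m s F} (hK : ∀ v, K *ᵥ v = 0 → v = 0) :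
    ∃ L : Matrix s m F, L * K = 1 := by
  obtain ⟨g, hg⟩ := LinearMap.exists_leftInverse_of_injective (Matrix.toLin' K)
    (by rw [LinearMap.ker_eq_bot']; simpa using hK)
  refine ⟨LinearMap.toMatrix' g, ?_⟩
  have := congrArg LinearMap.toMatrix' hg
  rwa [LinearMap.toMatrix'_comp, LinearMap.toMatrix'_toLin', LinearMap.toMatrix'_id] at this

theorem similar_toMatrix (G : Matrix n n F) {i : Type*} [Fintype i] [DecidableEq i]
    (b : Module.Basis i F (n → F)) : Similar G (LinearMap.toMatrix b b (Matrix.toLin' G)) := by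
  refine ⟨(Pi.basisFun F n).toMatrix b, b.toMatrix (Pi.basisFun F n), ?_, ?_, ?_⟩
  · exact Module.Basis.toMatrix_mul_toMatrix_flip _ _
  · exact Module.Basis.toMatrix_mul_toMatrix_flip _ _
  · rw [basis_toMatrix_mul_linearMap_toMatrix_mul_basis_toMatrix, LinearMap.toMatrix_eq_toMatrix',
      LinearMap.toMatrix'_toLin']

/-- In a basis adapted to the eigenspace of `G` for the eigenvalue `1`. -/
theorem exists_similar_fromBlocks_one (G : Matrix n n F) :
    ∃ (r s : ℕ) (H : Matrix (Fin r) (Fin s) F) (G₂ : Matrix (Fin s) (Fin s) F)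
      (L₁ : Matrix (Fin s) (Fin r) F) (L₂ : Matrix (Fin s) (Fin s) F),
      Similar G (fromBlocks 1 H 0 G₂) ∧ L₁ * H + L₂ * (G₂ - 1) = 1 := by
  set W := LinearMap.ker (Matrix.toLin' (G - 1)) with hW
  obtain ⟨C, hC⟩ := exists_isCompl W
  set bW := Module.finBasis F W
  set bC := Module.finBasis F C
  set b := (bW.prod bC).map (Submodule.prodEquivOfIsCompl W C hC) with hb
  set M := LinearMap.toMatrix b b (Matrix.toLin' G) with hM
  have hGW : ∀ x ∈ W, G *ᵥ x = x := by
    intro x hx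
    simpa [hW, sub_eq_zero] using hx
  have hbl : ∀ i, b (.inl i) ∈ W := fun i => by simp [hb]
  have hbr : ∀ i, b (.inr i) ∈ C := fun i => by simp [hb]
  have hMl : ∀ i j, M i (.inl j) = if i = .inl j then 1 else 0 := by
    intro i j
    rw [hM, LinearMap.toMatrix_apply, Matrix.toLin'_apply, hGW _ (hbl j), b.repr_self,
      Finsupp.single_apply]
    simp only [eq_comm]
  have hMb : M = fromBlocks 1 M.toBlocks₁₂ 0 M.toBlocks₂₂ := by
    ext (i | i) (j | j) <;> simp [hMl, Matrix.one_apply, toBlocks₁₂, toBlocks₂₂]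
  obtain ⟨L, hL⟩ := exists_mul_eq_one_of_mulVec_injective
    (K := fromRows M.toBlocks₁₂ (M.toBlocks₂₂ - 1)) (by
    intro v hv
    set z : Fin (Module.finrank F W) ⊕ Fin (Module.finrank F C) → F := Sum.elim 0 v with hz
    set x : n → F := ∑ j, v j • b (.inr j) with hx
    have hxC : x ∈ C := Submodule.sum_mem _ fun j _ => C.smul_mem _ (hbr j)
    have hrep : b.equivFun x = z := by
      have : x = ∑ j, z j • b j := by simp [hx, hz]
      rw [this, b.equivFun_apply, b.repr_sum_self]
    have hxW : x ∈ W := by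
      have h1 : M *ᵥ b.repr x = b.repr (G *ᵥ x) := by
        rw [hM, LinearMap.toMatrix_mulVec_repr, Matrix.toLin'_apply]
      have h2 : M *ᵥ z = z := by
        rw [fromRows_mulVec] at hv
        have hv1 := congrArg (· ∘ Sum.inl) hv
        have hv2 := congrArg (· ∘ Sum.inr) hv
        simp only [Sum.elim_comp_inl, Sum.elim_comp_inr, Matrix.sub_mulVec,
          Matrix.one_mulVec] at hv1 hv2
        rw [hMb, fromBlocks_mulVec, hz]
        ext (i | i)
        · simpa [Function.comp_def] using congrFun hv1 i
        · simpa [Function.comp_def, sub_eq_zero] using congrFun hv2 i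
      rw [show (b.repr x : _ → F) = z from hrep, h2, ← hrep] at h1
      have h3 : G *ᵥ x = x := by
        apply b.equivFun.injective
        exact h1.symm
      simp [hW, h3]
    have hx0 : x = 0 := by
      have : x ∈ W ⊓ C := ⟨hxW, hxC⟩
      rwa [hC.inf_eq_bot] at this
    rw [hx0, map_zero] at hrep
    ext j
    simpa [hz] using (congrFun hrep (.inr j)).symm)
  refine ⟨_, _, M.toBlocks₁₂, M.toBlocks₂₂, L.toCols₁, L.toCols₂, ?_, ?_⟩
  · rw [← hMb]; exact similar_toMatrix G b
  · rw [← fromCols_mul_fromRows, fromCols_toCols, hL]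

end KernelBasis

section Pivot

variable {F : Type*} [Field F]

/-- `G` is not a scalar multiple of the identity. -/
def IsNonscalar {n : Type*} [DecidableEq n] (G : Matrix n n F) : Prop := ∀ c : F, G ≠ c • 1

theorem IsNonscalar.exists_similar_apply_ne {n : Type*} [Fintype n] [DecidableEq n]
    {G : Matrix n n F} (hG : IsNonscalar G) :
    ∃ (Q : Matrix n n F) (i j : n), Similar G Q ∧ i ≠ j ∧ Q i j ≠ 0 := by
  by_cases h : ∃ i j, i ≠ j ∧ G i j ≠ 0
  · obtain ⟨i, j, hij, hG'⟩ := h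
    exact ⟨G, i, j, .refl G, hij, hG'⟩
  push Not at h
  have hdiag : ∃ i j, G i i ≠ G j j := by
    by_contra! hc
    rcases isEmpty_or_nonempty n with hn | ⟨⟨k⟩⟩
    · exact hG 0 (by ext i; exact hn.elim i)
    · refine hG (G k k) ?_
      ext i j
      by_cases hij : i = j
      · subst hij; simp [hc i k]
      · simp [hij, h i j hij]
  obtain ⟨i, j, hij⟩ := hdiag
  have hij' : i ≠ j := fun h => hij (h ▸ rfl)
  obtain ⟨g, rfl⟩ : ∃ g, G = diagonal g := by
    refine ⟨fun k => G k k, ?_⟩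
    ext k l
    by_cases hkl : k = l
    · subst hkl; simp
    · simp [hkl, h k l hkl]
  simp only [diagonal_apply_eq] at hij
  have hsq : ∀ x y : F, single i j x * single i j y = 0 := fun x y => by
    simp [hij'.symm]
  refine ⟨diagonal g + single i j (g i - g j), i, j, ?_, hij', ?_⟩
  · refine Similar.of_mul_eq (T := 1 + single i j 1) ?_ ?_
    · refine IsUnit.of_mul_eq_one (1 - single i j 1) ?_
      simp [mul_sub, add_mul, hsq]
    · simp only [Matrix.mul_add, Matrix.add_mul, Matrix.one_mul, hsq, add_zero, Matrix.mul_one]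
      rw [add_assoc]
      congr 1
      ext k l
      rw [Matrix.add_apply, diagonal_mul, mul_diagonal, Matrix.single_apply, Matrix.single_apply]
      split_ifs with hkl
      · rw [← hkl.1, ← hkl.2]; ring
      · simp
  · simp [hij', sub_ne_zero.2 hij]

theorem similar_fromBlocks_shear {u p : Type*} [Fintype u] [Fintype p] [DecidableEq u]
    [DecidableEq p] (a : Matrix u u F) (c : Matrix u p F) (b : Matrix p u F) (D : Matrix p p F)
    (l : Matrix u p F) :
    Similar (fromBlocks a c b D)
      (fromBlocks (a + l * b) (c + l * D - (a + l * b) * l) b (D - b * l)) := by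
  refine Similar.symm (Similar.of_mul_eq (T := fromBlocks 1 l 0 1)
    (isUnit_fromBlocks_upper isUnit_one isUnit_one _) ?_)
  simp [fromBlocks_multiply]

theorem det_fromBlocks_smul_one {p : Type*} [Fintype p] [DecidableEq p] {a : F} (ha : a ≠ 0)
    (c : Matrix Unit p F) (b : Matrix p Unit F) (D : Matrix p p F) :
    (fromBlocks (a • 1 : Matrix Unit Unit F) c b D).det = a * (D - a⁻¹ • (b * c)).det := by
  have : fromBlocks (a • 1 : Matrix Unit Unit F) c b D
      = fromBlocks (a • 1 : Matrix Unit Unit F) 0 b 1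
        * fromBlocks (1 : Matrix Unit Unit F) (a⁻¹ • c) 0 (D - a⁻¹ • (b * c)) := by
    simp [fromBlocks_multiply, smul_smul, ha]
  rw [this, Matrix.det_mul, det_fromBlocks_zero₁₂, det_fromBlocks_zero₂₁]
  simp

/-- A nonscalar matrix can be given any nonzero leading entry, with the Schur complement again
nonscalar when its size is at least two. -/
theorem IsNonscalar.exists_pivot {m : ℕ} {G : Matrix (Fin (m + 1)) (Fin (m + 1)) F}
    (hG : IsNonscalar G) (hdet : G.det ≠ 0) {a : F} (ha : a ≠ 0) :
    ∃ (c : Matrix Unit (Fin m) F) (b : Matrix (Fin m) Unit F) (D : Matrix (Fin m) (Fin m) F),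
      Similar G (fromBlocks (a • 1) c b D) ∧ (IsNonscalar (D - a⁻¹ • (b * c)) ∨ m ≤ 1) := by
  obtain ⟨Q, i, j, hGQ, hij, hQ⟩ := hG.exists_similar_apply_ne
  obtain ⟨e₀⟩ : Nonempty (Fin (m + 1) ≃ Unit ⊕ Fin m) :=
    Fintype.card_eq.1 (by simp [add_comm])
  set e := (Equiv.swap j (e₀.symm (.inl ()))).trans e₀ with he
  have hej : e j = .inl () := by simp [he]
  set Q' := Q.submatrix e.symm e.symm with hQ'
  have hGQ' : Similar G Q' := hGQ.trans (Similar.of_submatrix e (by simp [hQ']))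
  obtain ⟨k, hk⟩ : ∃ k, e i = .inr k := by
    rcases h : e i with ⟨⟩ | k
    · exact absurd (e.injective (h.trans hej.symm)) hij
    · exact ⟨k, rfl⟩
  set b := Q'.toBlocks₂₁ with hb
  have hbk : b k () ≠ 0 := by
    simpa [hb, toBlocks₂₁, hQ', ← hk, ← hej] using hQ
  obtain ⟨α, hα⟩ : ∃ α : F, Q'.toBlocks₁₁ = α • 1 := ⟨Q'.toBlocks₁₁ () (), by ext; simp⟩
  have hstep : ∃ (c : Matrix Unit (Fin m) F) (D : Matrix (Fin m) (Fin m) F),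
      Similar G (fromBlocks (a • 1) c b D) := by
    have h := similar_fromBlocks_shear Q'.toBlocks₁₁ Q'.toBlocks₁₂ b Q'.toBlocks₂₂
      (of fun _ x => if x = k then (a - α) / b k () else 0)
    rw [fromBlocks_toBlocks] at h
    have e1 : Q'.toBlocks₁₁ + (of fun _ x => if x = k then (a - α) / b k () else 0) * b
        = a • (1 : Matrix Unit Unit F) := by
      rw [hα]
      ext
      simp [Matrix.mul_apply, hbk]
    rw [e1] at h
    exact ⟨_, _, hGQ'.trans h⟩
  obtain ⟨c, D, hs⟩ := hstep
  by_cases hns : IsNonscalar (D - a⁻¹ • (b * c)) ∨ m ≤ 1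
  · exact ⟨c, b, D, hs, hns⟩
  push Not at hns
  obtain ⟨hns, hm⟩ := hns
  obtain ⟨μ, hμ⟩ : ∃ μ : F, D - a⁻¹ • (b * c) = μ • 1 := by
    simpa [IsNonscalar] using hns
  have hμ0 : μ ≠ 0 := by
    rintro rfl
    apply hdet
    have : Nonempty (Fin m) := ⟨k⟩
    rw [hs.det_eq, det_fromBlocks_smul_one ha, hμ, zero_smul, Matrix.det_zero, mul_zero]
  obtain ⟨k', hk'⟩ : ∃ k', k' ≠ k := by
    have : Nontrivial (Fin m) := Fin.nontrivial_iff_two_le.2 hm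
    exact exists_ne k
  set l : Matrix Unit (Fin m) F :=
    of fun _ x => if x = k' then b k () else if x = k then -b k' () else 0 with hl
  have hlb : l * b = 0 := by
    ext
    rw [Matrix.mul_apply, Finset.sum_eq_add (a := k') (b := k) hk']
    · simp [hl, hk'.symm]; ring
    · rintro x - ⟨hx, hx'⟩; simp [hl, hx, hx']
    · simp
    · simp
  have h := similar_fromBlocks_shear (a • 1) c b D l
  rw [hlb, add_zero] at h
  refine ⟨_, b, _, hs.trans h, .inl ?_⟩
  have hD : D = μ • 1 + a⁻¹ • (b * c) := by rw [← hμ]; abel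
  have hlD : l * D = μ • l := by
    rw [hD, Matrix.mul_add, Matrix.mul_smul, Matrix.mul_smul, ← Matrix.mul_assoc, hlb]; simp
  have hS : D - b * l - a⁻¹ • (b * (c + l * D - (a • 1 : Matrix Unit Unit F) * l))
      = μ • 1 - (a⁻¹ * μ) • (b * l) := by
    rw [hlD, ← hμ, Matrix.smul_mul, Matrix.one_mul, Matrix.mul_sub, Matrix.mul_add, Matrix.mul_smul,
      Matrix.mul_smul, smul_sub, smul_add, smul_smul, smul_smul, inv_mul_cancel₀ ha, one_smul]
    abel
  rw [hS]
  intro ν hν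
  have hbl : b * l = ((a⁻¹ * μ)⁻¹ * (μ - ν)) • 1 := by
    have h0 : a⁻¹ * μ ≠ 0 := mul_ne_zero (inv_ne_zero ha) hμ0
    rw [mul_smul, sub_smul, ← hν, sub_sub_cancel, smul_smul, inv_mul_cancel₀ h0, one_smul]
  have hkk : (b * l) k k' ≠ 0 := by
    simp [Matrix.mul_apply, hl, hbk]
  rw [hbl] at hkk
  simp [hk'.symm] at hkk

end Pivot

section NegUnipotentFactors

variable {F : Type*} [Field F]

/-- `G` is a product of two matrices whose only eigenvalue is `-1`. -/
def HasNegUnipotentFactors {n : Type*} [Fintype n] [DecidableEq n] (G : Matrix n n F) : Prop :=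
  ∃ X Y, G = X * Y ∧ IsNilpotent (X + 1) ∧ IsNilpotent (Y + 1)

theorem isNilpotent_conj {m n : Type*} [Fintype m] [Fintype n] [DecidableEq m] [DecidableEq n]
    {S : Matrix m n F} {S' : Matrix n m F} (h1 : S * S' = 1) (h2 : S' * S = 1) {X : Matrix n n F}
    (hX : IsNilpotent (X + 1)) : IsNilpotent (S * X * S' + 1) := by
  obtain ⟨k, hk⟩ := hX
  refine ⟨k + 1, ?_⟩
  have e : S * X * S' + 1 = S * (X + 1) * S' := by
    rw [Matrix.mul_add, Matrix.add_mul, Matrix.mul_one, h1]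
  have key : ∀ j : ℕ, (S * (X + 1) * S') ^ (j + 1) = S * (X + 1) ^ (j + 1) * S' := by
    intro j
    induction j with
    | zero => simp
    | succ j ih =>
      rw [pow_succ, ih, show S * (X + 1) ^ (j + 1) * S' * (S * (X + 1) * S')
        = S * (X + 1) ^ (j + 1) * (S' * S) * (X + 1) * S' by simp only [Matrix.mul_assoc], h2,
        Matrix.mul_one, pow_succ _ (j + 1), Matrix.mul_assoc S]
  rw [e, key, pow_succ, hk]
  simp

theorem HasNegUnipotentFactors.of_similar {m n : Type*} [Fintype m] [Fintype n] [DecidableEq m]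
    [DecidableEq n] {P : Matrix m m F} {Q : Matrix n n F} (h : Similar P Q)
    (hQ : HasNegUnipotentFactors Q) : HasNegUnipotentFactors P := by
  obtain ⟨S, S', h1, h2, rfl⟩ := h
  obtain ⟨X, Y, rfl, hX, hY⟩ := hQ
  refine ⟨S * X * S', S * Y * S', ?_, isNilpotent_conj h1 h2 hX, isNilpotent_conj h1 h2 hY⟩
  rw [show S * X * S' * (S * Y * S') = S * X * (S' * S) * Y * S' by simp only [Matrix.mul_assoc],
    h2]
  simp only [Matrix.mul_assoc, Matrix.mul_one]

theorem HasNegUnipotentFactors.one {n : Type*} [Fintype n] [DecidableEq n] :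
    HasNegUnipotentFactors (1 : Matrix n n F) := ⟨-1, -1, by simp⟩

theorem eq_one_of_det_eq_one {m : ℕ} (hm : m ≤ 1) {G : Matrix (Fin m) (Fin m) F}
    (h : G.det = 1) : G = 1 := by
  obtain rfl | rfl : m = 0 ∨ m = 1 := by omega
  · exact Subsingleton.elim _ _
  · rw [det_fin_one] at h
    ext i j
    rw [Subsingleton.elim i 0, Subsingleton.elim j 0, h, Matrix.one_apply_eq]

/-- The factorization theorem of Sourour for the spectrum `{-1}` on both factors. -/
theorem hasNegUnipotentFactors_of_det_eq_one {m : ℕ} {G : Matrix (Fin m) (Fin m) F}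
    (hG : IsNonscalar G ∨ m ≤ 1) (hdet : G.det = 1) : HasNegUnipotentFactors G := by
  induction m with
  | zero => rw [eq_one_of_det_eq_one (by omega) hdet]; exact .one
  | succ m ih =>
    rcases hG with hG | hm
    swap
    · rw [eq_one_of_det_eq_one hm hdet]; exact .one
    obtain ⟨c, b, D, hs, hS⟩ := hG.exists_pivot (by simp [hdet]) one_ne_zero
    rw [hs.det_eq, det_fromBlocks_smul_one one_ne_zero, one_mul] at hdet
    rw [one_smul] at hs
    simp only [inv_one, one_smul] at hS hdet
    obtain ⟨X, Y, hXY, hX, hY⟩ := ih hS hdet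
    refine .of_similar hs ⟨fromBlocks (-1) 0 (-b) X, fromBlocks (-1) (-c) 0 Y, ?_, ?_, ?_⟩
    · simp [fromBlocks_multiply, ← hXY]
    · rw [add_comm, one_add_fromBlocks, add_comm 1 X]
      exact isNilpotent_fromBlocks_lower (by simp) hX _
    · rw [add_comm, one_add_fromBlocks, add_comm 1 Y]
      exact isNilpotent_fromBlocks_upper (by simp) hY _

theorem exists_factorization_of_det_eq_neg_one {m : ℕ} {G : Matrix (Fin (m + 1)) (Fin (m + 1)) F}
    (hG : IsNonscalar G) (hdet : G.det = -1) :
    ∃ (X Y₂ : Matrix (Unit ⊕ Fin m) (Unit ⊕ Fin m) F) (y : Matrix Unit (Fin m) F)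
      (Y : Matrix (Fin m) (Fin m) F), Similar G (X * Y₂) ∧ IsNilpotent (X + 1) ∧
      IsNilpotent (Y + 1) ∧ Y₂ = fromBlocks 1 y 0 Y := by
  have hneg : (-1 : F) ≠ 0 := neg_ne_zero.2 one_ne_zero
  obtain ⟨c, b, D, hs, hS⟩ := hG.exists_pivot (by simp [hdet]) hneg
  rw [hs.det_eq, det_fromBlocks_smul_one hneg, neg_one_mul, neg_inj] at hdet
  obtain ⟨X, Y, hXY, hX, hY⟩ := hasNegUnipotentFactors_of_det_eq_one hS hdet
  refine ⟨fromBlocks (-1) 0 b X, fromBlocks 1 (-c) 0 Y, -c, Y, ?_, ?_, hY, rfl⟩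
  · convert hs using 1
    simp [fromBlocks_multiply, ← hXY, inv_neg]
  · rw [add_comm, one_add_fromBlocks, add_comm 1 X]
    exact isNilpotent_fromBlocks_lower (by simp) hX _

end NegUnipotentFactors

section Scalar

variable {F : Type*} [Field F]

theorem similar_emptySum {e n : Type*} [IsEmpty e] [Fintype e] [DecidableEq e] [Fintype n]
    [DecidableEq n] (A : Matrix e e F) (B : Matrix e n F) (C : Matrix n e F) (D : Matrix n n F) :
    Similar (fromBlocks A B C D) D :=
  Similar.symm (Similar.of_submatrix (Equiv.emptySum e n).symm (by ext; simp))

theorem isProdThree_of_twisted_commute {n : Type*} [Fintype n] [DecidableEq n]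
    {c c' Z Z' : Matrix n n F} {g : F} (hg : g ≠ 0) (hc : c * c' = 1) (hc' : c' * c = 1)
    (hZ : Z * Z' = 1) (hZc : Z * c = g • (c * Z)) (hg1 : g ≠ 1) :
    IsProdThree (-(fromBlocks 1 0 0 (g • 1) : Matrix (n ⊕ n) (n ⊕ n) F)) := by
  obtain ⟨G, hG⟩ : ∃ G : Matrix n n F, G = g • 1 := ⟨_, rfl⟩
  rw [← hG]
  set B : Matrix n n F := c' * (Z + 1 + c * c) with hB
  have hcB : c * B = Z + 1 + c * c := by rw [hB, ← Matrix.mul_assoc, hc, Matrix.one_mul]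
  have hBc : B * c = G * Z + 1 + c * c := by
    rw [hB, Matrix.mul_assoc, show (Z + 1 + c * c) * c = c * (g • Z + 1 + c * c) by
      rw [Matrix.add_mul, Matrix.add_mul, hZc]; simp [Matrix.mul_add, Matrix.mul_assoc],
      ← Matrix.mul_assoc, hc', Matrix.one_mul, hG]
    simp
  set C := B + (G - 1) * c + G + 1 with hC
  have hL : C = C * ((g - 1)⁻¹ • 1) * (G - 1) := by
    have : G - 1 = (g - 1) • 1 := by rw [hG, sub_smul, one_smul]
    rw [this]
    simp [smul_smul, mul_inv_cancel₀ (sub_ne_zero.2 hg1)]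
  have hT : IsUnit (fromBlocks (-(G * c) - 1) (c - B - G) 1 (B - c) :
      Matrix (n ⊕ n) (n ⊕ n) F) := by
    have hGu : IsUnit (-G) :=
      (IsUnit.of_mul_eq_one (g⁻¹ • 1) (by simp [hG, smul_smul, hg])).neg
    have hfac : (fromBlocks (-(G * c) - 1) (c - B - G) 1 (B - c) : Matrix (n ⊕ n) (n ⊕ n) F)
        = (fromBlocks 1 (-1) 0 1 : Matrix (n ⊕ n) (n ⊕ n) F) * fromBlocks (-G) 0 0 1
          * fromBlocks 1 c 0 1 * fromBlocks 0 (-Z) 1 (B - c) := by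
      simp only [fromBlocks_multiply]
      congr 1
      · noncomm_ring
      · linear_combination (norm := noncomm_ring) G * hcB
      · noncomm_ring
      · noncomm_ring
    rw [hfac]
    refine (((isUnit_fromBlocks_upper (A := (1 : Matrix n n F)) isUnit_one isUnit_one _).mul
      (isUnit_fromBlocks_upper hGu (D := (1 : Matrix n n F)) isUnit_one _)).mul
      (isUnit_fromBlocks_upper (A := (1 : Matrix n n F)) isUnit_one isUnit_one _)).mul ?_
    exact IsUnit.of_mul_eq_one (fromBlocks ((B - c) * Z') 1 (-Z') 0)
      (by simp [fromBlocks_multiply, hZ])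
  have hP : IsProdTwo (-(fromBlocks 1 C (-1) (G - C)) : Matrix (n ⊕ n) (n ⊕ n) F) := by
    refine isProdTwo_of_mul_eq_mul_companion B hT ?_
    rw [fromBlocks_neg]
    simp only [fromBlocks_multiply]
    congr 1
    · rw [hC]; noncomm_ring
    · rw [hC]; linear_combination (norm := noncomm_ring) hBc - G * hcB
    · rw [hC]; noncomm_ring
    · rw [hC]; linear_combination (norm := noncomm_ring) G * hcB - hBc
  have := isProdThree_of_isProdTwo_shift (d := Empty) (φ := 0) 0 (C * ((g - 1)⁻¹ • 1)) (by simp) hL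
    (IsProdTwo.of_similar (similar_emptySum _ _ _ _).neg hP)
  exact IsProdThree.of_similar (similar_emptySum _ _ _ _).symm.neg this

theorem isProdThree_neg_of_pow_eq_one {g : F} {s : ℕ} (hgs : g ^ s = 1) (hg1 : g ≠ 1) :
    IsProdThree (-(fromBlocks 1 0 0 (g • 1) : Matrix (Fin s ⊕ Fin s) (Fin s ⊕ Fin s) F)) := by
  obtain _ | s := s
  · exact ⟨0, 0, 0, by simp, by simp, by simp, Subsingleton.elim _ _⟩
  have hg : g ≠ 0 := by
    rintro rfl
    simp at hgs
  set c : Matrix (Fin (s + 1)) (Fin (s + 1)) F := of fun i j => if i = j + 1 then 1 else 0 with hc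
  have h1 : cᵀ * c = 1 := by
    ext i j
    simp [Matrix.mul_apply, hc, Matrix.one_apply, eq_comm]
  refine isProdThree_of_twisted_commute (c := c) (c' := cᵀ) (Z := diagonal fun i => g ^ (i : ℕ))
    (Z' := diagonal fun i => (g ^ (i : ℕ))⁻¹) hg (mul_eq_one_comm.1 h1) h1 ?_ ?_ hg1
  · rw [diagonal_mul_diagonal]
    simp [hg]
  · ext i j
    rw [diagonal_mul, Matrix.smul_apply, mul_diagonal]
    by_cases hij : i = j + 1
    · subst hij
      rw [Fin.val_add_one]
      split_ifs with hj
      · simp [hc, hj, ← pow_succ', hgs]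
      · simp [hc, pow_succ']
    · simp [hc, hij]

end Scalar

section NegativeScalar

variable {F : Type*} [Field F]

theorem similar_diagonal {m n : Type*} [Fintype m] [Fintype n] [DecidableEq m] [DecidableEq n]
    (e : m ≃ n) {u : m → F} {v : n → F} (h : ∀ i, u i = v (e i)) :
    Similar (diagonal u) (diagonal v) := by
  refine Similar.of_submatrix e ?_
  rw [submatrix_diagonal_equiv]
  exact congrArg diagonal (funext h)

theorem similar_smul_one {m n : Type*} [Fintype m] [Fintype n] [DecidableEq m] [DecidableEq n]
    (e : m ≃ n) (a : F) : Similar (a • 1 : Matrix m m F) (a • 1 : Matrix n n F) := by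
  rw [Matrix.smul_one_eq_diagonal, Matrix.smul_one_eq_diagonal]
  exact similar_diagonal e fun _ => rfl

theorem similar_one {m n : Type*} [Fintype m] [Fintype n] [DecidableEq m] [DecidableEq n]
    (e : m ≃ n) : Similar (1 : Matrix m m F) (1 : Matrix n n F) := by
  simpa using similar_smul_one e (1 : F)

theorem similar_fromBlocks_diagonal {m n : Type*} [Fintype m] [Fintype n] [DecidableEq m]
    [DecidableEq n] {u : m → F} {v : n → F} (N : Matrix m n F) (h : ∀ i j, u i ≠ v j) :
    Similar (fromBlocks (diagonal u) N 0 (diagonal v))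
      (fromBlocks (diagonal u) 0 0 (diagonal v)) := by
  refine Similar.of_mul_eq (T := fromBlocks 1 (of fun i j => N i j / (v j - u i)) 0 1)
    (isUnit_fromBlocks_upper isUnit_one isUnit_one _) ?_
  simp only [fromBlocks_multiply]
  congr 1
  · simp
  · ext i j
    have : v j - u i ≠ 0 := sub_ne_zero.2 (h i j).symm
    simp
    field_simp
    ring
  · simp
  · simp

theorem isUnit_diagonal_of_ne_zero {n : Type*} [Fintype n] [DecidableEq n] {u : n → F}
    (h : ∀ i, u i ≠ 0) : IsUnit (diagonal u) := by
  rw [Matrix.isUnit_iff_isUnit_det, det_diagonal, isUnit_iff_ne_zero]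
  exact Finset.prod_ne_zero_iff.2 fun i _ => h i

theorem pow_ne_one_of_minimal (h2 : (2 : F) ≠ 0) {g : F} {s : ℕ} (h : g ^ s = -1)
    (hmin : ∀ k, 0 < k → k < s → g ^ k ≠ -1) {k : ℕ} (hk : 0 < k) (hk' : k < 2 * s) :
    g ^ k ≠ 1 := by
  intro hgk
  rcases lt_trichotomy k s with hks | rfl | hks
  · refine hmin (s - k) (by omega) (by omega) ?_
    have := pow_sub_mul_pow g hks.le
    rwa [hgk, mul_one, h] at this
  · rw [h] at hgk
    exact h2 (by linear_combination -hgk)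
  · refine hmin (k - s) (by omega) (by omega) ?_
    rw [← Nat.sub_add_cancel hks.le, pow_add, h] at hgk
    linear_combination -hgk

theorem isProdThree_neg_of_pow_eq_neg_one (h2 : (2 : F) ≠ 0) {g : F} {m : ℕ}
    (h : g ^ (m + 1) = -1) (hmin : ∀ k, 0 < k → k < m + 1 → g ^ k ≠ -1) :
    IsProdThree (-(fromBlocks 1 0 0 (fromBlocks 1 0 0 (g • 1)) :
      Matrix (Fin 1 ⊕ (Fin (m + 1) ⊕ Fin (m + 1))) (Fin 1 ⊕ (Fin (m + 1) ⊕ Fin (m + 1))) F)) := by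
  have hg0 : g ≠ 0 := by
    rintro rfl
    simp at h
  have hne : ∀ {k : ℕ}, 0 < k → k < 2 * (m + 1) → g ^ k ≠ 1 := pow_ne_one_of_minimal h2 h hmin
  have hg1 : g ≠ 1 := by simpa using hne one_pos (by omega)
  set v : Fin 1 ⊕ Fin m → F := fun j => g ^ ((finSumFinEquiv j : ℕ) + 1) with hv
  set u : Fin m → F := fun i => (g ^ ((i : ℕ) + 1))⁻¹ with hu
  set Y : Matrix (Fin 1 ⊕ Fin m) (Fin 1 ⊕ Fin m) F := fromBlocks 1 0 0 (diagonal u) with hY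
  have hXY : diagonal v * Y = g • 1 := by
    rw [hY, ← diagonal_one, fromBlocks_diagonal, diagonal_mul_diagonal, smul_one_eq_diagonal]
    congr 1
    ext (j | j)
    · simp [hv]
    · have : g ^ ((j : ℕ) + 1) ≠ 0 := pow_ne_zero _ hg0
      simp only [hv, hu, Sum.elim_inr, finSumFinEquiv_apply_right, Fin.val_natAdd]
      rw [add_comm 1 (j : ℕ), pow_succ' g ((j : ℕ) + 1), mul_assoc, mul_inv_cancel₀ this, mul_one]
  have hX1 : IsUnit (diagonal v - 1) := by
    rw [← diagonal_one, diagonal_sub]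
    exact isUnit_diagonal_of_ne_zero fun j => sub_ne_zero.2 (hne (by omega) (by omega))
  have hY1 : IsUnit (diagonal u - 1) := by
    rw [← diagonal_one, diagonal_sub]
    exact isUnit_diagonal_of_ne_zero fun j => sub_ne_zero.2
      (inv_ne_one.2 (hne (by omega) (by omega)))
  have hR : IsProdTwo (-(fromBlocks (diagonal u) (fromCols 0 (-1)) 0 (diagonal v) :
      Matrix (Fin m ⊕ (Fin 1 ⊕ Fin m)) (Fin m ⊕ (Fin 1 ⊕ Fin m)) F)) := by
    have hs1 := similar_fromBlocks_diagonal (u := u) (v := v)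
      (fromCols 0 (-1) : Matrix (Fin m) (Fin 1 ⊕ Fin m) F) (by
        intro i j hij
        refine hne (k := (i : ℕ) + 1 + ((finSumFinEquiv j : ℕ) + 1)) (by omega) (by omega) ?_
        rw [pow_add]
        change g ^ ((i : ℕ) + 1) * v j = 1
        rw [← hij]
        exact mul_inv_cancel₀ (pow_ne_zero _ hg0))
    set D : Matrix (Fin m) (Fin m) F := diagonal fun i => g ^ ((i : ℕ) + 1) with hD
    have hs2 : Similar (fromBlocks (diagonal u) 0 0 (diagonal v))
        (fromBlocks (fromBlocks (diagonal u) 0 0 D) 0 0 (-1 : Matrix (Fin 1) (Fin 1) F)) := by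
      rw [hD, ← diagonal_one, diagonal_neg, fromBlocks_diagonal, fromBlocks_diagonal,
        fromBlocks_diagonal]
      refine similar_diagonal (((Equiv.refl _).sumCongr ((finSumFinEquiv.trans
        (finCongr (add_comm 1 m))).trans finSumFinEquiv.symm)).trans
        (Equiv.sumAssoc _ _ _).symm) ?_
      rintro (i | j)
      · simp
      · set x := ((finSumFinEquiv.trans (finCongr (add_comm 1 m))).trans finSumFinEquiv.symm) j
          with hx
        have hxj : (finSumFinEquiv x : ℕ) = finSumFinEquiv j := by simp [hx]
        have hvj : v j = g ^ ((finSumFinEquiv x : ℕ) + 1) := by rw [hxj]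
        rw [Sum.elim_inr, hvj]
        change _ = Sum.elim _ _ ((Equiv.sumAssoc _ _ _).symm (.inr x))
        rcases x with x | x
        · simp
        · simp [h]
    refine IsProdTwo.of_similar (hs1.trans hs2).neg ?_
    simp only [fromBlocks_neg, neg_neg, neg_zero]
    have hDu : D * diagonal u = 1 := by
      rw [hD, diagonal_mul_diagonal, ← diagonal_one]
      congr 1
      ext i
      exact mul_inv_cancel₀ (pow_ne_zero _ hg0)
    refine IsProdTwo.fromBlocks (isProdTwo_fromBlocks_inverse (D := -D)
      (D' := -diagonal u) (by rw [neg_mul_neg, hDu])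
      (by rw [neg_mul_neg, mul_eq_one_comm.1 hDu]) ?_)
      (IsProdTwo.one (R := Matrix (Fin 1) (Fin 1) F))
    rw [hD, diagonal_neg, diagonal_neg, diagonal_sub]
    refine isUnit_diagonal_of_ne_zero fun i hi => ?_
    refine hne (k := (i : ℕ) + 1 + ((i : ℕ) + 1)) (by omega) (by omega) ?_
    have h3 : g ^ ((i : ℕ) + 1) = u i := by linear_combination -hi
    rw [pow_add]
    nth_rewrite 2 [h3]
    exact mul_inv_cancel₀ (pow_ne_zero _ hg0)
  have key := isProdThree_of_isProdTwo_remainder (H := (0 : Matrix (Fin 0) (Fin 1 ⊕ Fin m) F))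
    hX1 hY1 hY hR 0 ((g - 1)⁻¹ • 1) (by
      have : g • (1 : Matrix (Fin 1 ⊕ Fin m) (Fin 1 ⊕ Fin m) F) - 1 = (g - 1) • 1 := by
        rw [sub_smul, one_smul]
      rw [hXY, this]
      simp [smul_smul, sub_ne_zero.2 hg1])
  rw [hXY] at key
  refine IsProdThree.of_similar (Similar.neg ?_) key
  have e := (finCongr (add_comm m 1)).trans (finSumFinEquiv (m := 1) (n := m)).symm
  have e' : Fin (m + 1) ≃ Fin 0 ⊕ (Fin 1 ⊕ Fin m) := e.trans (Equiv.emptySum _ _).symm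
  exact (Similar.refl _).fromBlocks ((similar_one e').fromBlocks
    ((similar_smul_one e g).trans (similar_emptySum _ _ _ _).symm))

end NegativeScalar

section NegExtension

variable {F : Type*} [Field F] {d d' m n p : Type*} [Fintype d] [Fintype d'] [Fintype m]
  [Fintype n] [Fintype p] [DecidableEq d] [DecidableEq d'] [DecidableEq m] [DecidableEq n]
  [DecidableEq p]

/-- The negative of `G`, extended by `-1` of the size of `G` plus an excess indexed by `d`, is a
product of three U2-matrices. -/
def HasNegExtension (d : Type*) [Fintype d] [DecidableEq d] (G : Matrix n n F) : Prop :=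
  IsProdThree (-(fromBlocks 1 0 0 (fromBlocks 1 0 0 G)) : Matrix (d ⊕ (n ⊕ n)) (d ⊕ (n ⊕ n)) F)

theorem Similar.card_eq {P : Matrix m m F} {Q : Matrix n n F} (h : Similar P Q) :
    Fintype.card m = Fintype.card n := by
  obtain ⟨S, S', h1, h2, -⟩ := h
  exact (Matrix.square_of_invertible S' S h2 h1).symm

theorem HasNegExtension.of_similar {G : Matrix n n F} {G' : Matrix m m F} (e : d ≃ d')
    (h : Similar G G') (hG' : HasNegExtension d' G') : HasNegExtension d G :=
  IsProdThree.of_similar ((similar_one e).fromBlocks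
    ((similar_one (Fintype.equivOfCardEq h.card_eq)).fromBlocks h)).neg hG'

theorem similar_fromBlocks_assoc (A : Matrix m m F) (B : Matrix n n F) (C : Matrix p p F) :
    Similar (fromBlocks (fromBlocks A 0 0 B) 0 0 C) (fromBlocks A 0 0 (fromBlocks B 0 0 C)) := by
  refine Similar.of_submatrix (Equiv.sumAssoc _ _ _) ?_
  ext ((i | i) | i) ((j | j) | j) <;> simp

theorem similar_fromBlocks_comm (A : Matrix m m F) (B : Matrix n n F) :
    Similar (fromBlocks A 0 0 B) (fromBlocks B 0 0 A) := by
  refine Similar.of_submatrix (Equiv.sumComm _ _) ?_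
  ext (i | i) (j | j) <;> simp

theorem similar_fromBlocks_interchange {q : Type*} [Fintype q] [DecidableEq q] (A : Matrix m m F)
    (B : Matrix n n F) (C : Matrix p p F) (D : Matrix q q F) :
    Similar (fromBlocks (fromBlocks A 0 0 B) 0 0 (fromBlocks C 0 0 D))
      (fromBlocks (fromBlocks A 0 0 C) 0 0 (fromBlocks B 0 0 D)) := by
  refine Similar.of_submatrix (Equiv.sumSumSumComm _ _ _ _) ?_
  ext ((i | i) | (i | i)) ((j | j) | (j | j)) <;> simp

theorem HasNegExtension.fromBlocks {G : Matrix n n F} {G' : Matrix m m F}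
    (h : HasNegExtension d G) (h' : HasNegExtension d' G') :
    HasNegExtension (d ⊕ d') (fromBlocks G 0 0 G') := by
  have := IsProdThree.fromBlocks h h'
  refine IsProdThree.of_similar ?_ this
  rw [show ∀ (P : Matrix (d ⊕ (n ⊕ n)) (d ⊕ (n ⊕ n)) F) (Q : Matrix (d' ⊕ (m ⊕ m)) _ F),
    Matrix.fromBlocks (-P) 0 0 (-Q) = -Matrix.fromBlocks P 0 0 Q by simp [fromBlocks_neg]]
  refine Similar.neg (Similar.symm ?_)
  refine (similar_fromBlocks_interchange _ _ _ _).trans ?_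
  rw [fromBlocks_one]
  refine (Similar.refl _).fromBlocks ((similar_fromBlocks_interchange _ _ _ _).trans ?_)
  rw [fromBlocks_one]
  exact .refl _

theorem hasNegExtension_iff_of_isEmpty [IsEmpty d] {G : Matrix n n F} :
    HasNegExtension d G ↔ IsProdThree (-(Matrix.fromBlocks 1 0 0 G) : Matrix (n ⊕ n) (n ⊕ n) F) :=
  ⟨IsProdThree.of_similar (similar_emptySum _ _ _ _).symm.neg,
    IsProdThree.of_similar (similar_emptySum _ _ _ _).neg⟩

theorem HasNegExtension.one [IsEmpty d] : HasNegExtension d (1 : Matrix n n F) := by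
  rw [hasNegExtension_iff_of_isEmpty]
  have h := (isProdTwo_neg_fromBlocks_one (F := F) (J := (1 : Matrix n n F))
    isUnit_one).isProdThree_mul (a := Matrix.fromBlocks 0 (-1) 0 0) (by simp [fromBlocks_multiply])
  convert h using 1
  rw [one_add_fromBlocks, mul_neg]
  simp [fromBlocks_multiply]

theorem hasNegExtension_of_factorization (h2 : (2 : F) ≠ 0) {r w : Type*} [Fintype r]
    [DecidableEq r] [Fintype w] [DecidableEq w] {G₂ : Matrix n n F} {H : Matrix w n F}
    {X Y₂ : Matrix (d ⊕ r) (d ⊕ r) F} {y : Matrix d r F} {Y : Matrix r r F}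
    (hG₂ : Similar G₂ (X * Y₂))
    (hX : IsNilpotent (X + 1)) (hY : IsNilpotent (Y + 1)) (hY₂ : Y₂ = Matrix.fromBlocks 1 y 0 Y)
    {L₁ : Matrix n w F} {L₂ : Matrix n n F} (hL : L₁ * H + L₂ * (G₂ - 1) = 1) :
    HasNegExtension d (Matrix.fromBlocks 1 H 0 G₂) := by
  obtain ⟨S, S', h1, h3, rfl⟩ := hG₂
  have key := isProdThree_of_isNilpotent h2 (H := H * S) hX hY hY₂ (S' * L₁) (S' * L₂ * S) (by
    have := congrArg (fun M => S' * M * S) hL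
    simp only [Matrix.mul_add, Matrix.add_mul, Matrix.mul_sub, Matrix.sub_mul, Matrix.mul_one,
      Matrix.mul_assoc] at this ⊢
    rw [h3] at this
    rw [← this]
    simp only [Matrix.mul_one])
  refine HasNegExtension.of_similar (Equiv.refl d) ?_ key
  exact ⟨Matrix.fromBlocks 1 0 0 S, Matrix.fromBlocks 1 0 0 S', by simp [fromBlocks_multiply, h1],
    by simp [fromBlocks_multiply, h3],
    by simp [fromBlocks_multiply, Matrix.mul_assoc, h1]⟩

theorem hasNegExtension_of_hasNegUnipotentFactors (h2 : (2 : F) ≠ 0) {w : Type*} [Fintype w]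
    [DecidableEq w] [IsEmpty d] {G₂ : Matrix n n F} {H : Matrix w n F}
    (hG₂ : HasNegUnipotentFactors G₂)
    {L₁ : Matrix n w F} {L₂ : Matrix n n F} (hL : L₁ * H + L₂ * (G₂ - 1) = 1) :
    HasNegExtension d (Matrix.fromBlocks 1 H 0 G₂) := by
  obtain ⟨X, Y, rfl, hX, hY⟩ := hG₂
  refine hasNegExtension_of_factorization h2 (X := Matrix.fromBlocks 1 0 0 X)
    (Y₂ := Matrix.fromBlocks 1 0 0 Y) (y := 0) ?_ ?_ hY rfl hL
  · simpa [fromBlocks_multiply] using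
      (similar_emptySum (1 : Matrix d d F) 0 0 (X * Y)).symm
  · rw [add_comm, one_add_fromBlocks, add_comm 1 X]
    exact isNilpotent_fromBlocks_upper (by simp [Subsingleton.elim (1 + 1 : Matrix d d F) 0]) hX _

theorem similar_fromBlocks_smul_one {g : F} (hg1 : g ≠ 1) (H : Matrix m n F) :
    Similar (fromBlocks 1 H 0 (g • 1)) (fromBlocks 1 0 0 (g • 1) : Matrix (m ⊕ n) (m ⊕ n) F) := by
  have hu : IsUnit (g • (1 : Matrix n n F) - 1) := by
    refine IsUnit.of_mul_eq_one ((g - 1)⁻¹ • 1) ?_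
    rw [show g • (1 : Matrix n n F) - 1 = (g - 1) • 1 by rw [sub_smul, one_smul]]
    simp [smul_smul, sub_ne_zero.2 hg1]
  simpa using similar_diag_of_isUnit_sub_one (N := (0 : Matrix m m F)) H (by simp) hu

theorem hasNegExtension_smul_one [IsEmpty d] {g : F} {s : ℕ} (hgs : g ^ s = 1) :
    HasNegExtension d (g • (1 : Matrix (Fin s) (Fin s) F)) := by
  rcases eq_or_ne g 1 with rfl | hg1
  · simpa using HasNegExtension.one
  · exact hasNegExtension_iff_of_isEmpty.2 (isProdThree_neg_of_pow_eq_one hgs hg1)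

theorem hasNegExtension_smul_one_of_pow_eq_neg_one [Unique d] (h2 : (2 : F) ≠ 0) {g : F} {s : ℕ}
    (hgs : g ^ s = -1) : HasNegExtension d (g • (1 : Matrix (Fin s) (Fin s) F)) := by
  classical
  have hex : ∃ k, 0 < k ∧ g ^ k = -1 := by
    refine ⟨s, Nat.pos_of_ne_zero ?_, hgs⟩
    rintro rfl
    exact h2 (by linear_combination hgs)
  obtain ⟨hpos, hk⟩ := Nat.find_spec hex
  have hmin : ∀ j, 0 < j → j < Nat.find hex → g ^ j ≠ -1 := fun j hj hjk h =>
    Nat.find_min hex hjk ⟨hj, h⟩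
  have hle : Nat.find hex ≤ s := Nat.find_min' hex ⟨Nat.pos_of_ne_zero (by
    rintro rfl
    exact h2 (by linear_combination hgs)), hgs⟩
  generalize Nat.find hex = k at *
  obtain ⟨k, rfl⟩ := Nat.exists_eq_add_of_lt hpos
  obtain ⟨t, rfl⟩ := Nat.exists_eq_add_of_le hle
  rw [pow_add, hk, neg_one_mul, neg_inj] at hgs
  rw [zero_add] at *
  have h := HasNegExtension.fromBlocks (isProdThree_neg_of_pow_eq_neg_one h2 hk hmin)
    (hasNegExtension_smul_one (d := Empty) hgs)
  refine HasNegExtension.of_similar ?_ ?_ h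
  · exact (Equiv.ofUnique d (Fin 1)).trans (Equiv.sumEmpty _ _).symm
  · rw [smul_one_eq_diagonal, smul_one_eq_diagonal, smul_one_eq_diagonal, fromBlocks_diagonal]
    exact similar_diagonal finSumFinEquiv.symm fun _ => by simp

theorem hasNegExtension_of_det_eq_one (h2 : (2 : F) ≠ 0) [IsEmpty d] {n : ℕ}
    {G : Matrix (Fin n) (Fin n) F} (hG : G.det = 1) : HasNegExtension d G := by
  obtain ⟨r, s, H, G₂, L₁, L₂, hs, hL⟩ := exists_similar_fromBlocks_one G
  rw [hs.det_eq, det_fromBlocks_zero₂₁, det_one, one_mul] at hG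
  refine .of_similar (.refl d) hs ?_
  by_cases h : IsNonscalar G₂
  · exact hasNegExtension_of_hasNegUnipotentFactors h2
      (hasNegUnipotentFactors_of_det_eq_one (.inl h) hG) hL
  simp only [IsNonscalar, not_forall, not_not] at h
  obtain ⟨g, rfl⟩ := h
  rcases eq_or_ne g 1 with rfl | hg1
  · exact hasNegExtension_of_hasNegUnipotentFactors h2 (by simpa using .one) hL
  refine .of_similar ((Equiv.sumEmpty d d).symm) (similar_fromBlocks_smul_one hg1 H)
    (HasNegExtension.fromBlocks .one (hasNegExtension_smul_one ?_))
  simpa using hG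

theorem hasNegExtension_of_det_eq_neg_one (h2 : (2 : F) ≠ 0) {n : ℕ}
    {G : Matrix (Fin n) (Fin n) F} (hG : G.det = -1) : HasNegExtension Unit G := by
  obtain ⟨r, s, H, G₂, L₁, L₂, hs, hL⟩ := exists_similar_fromBlocks_one G
  rw [hs.det_eq, det_fromBlocks_zero₂₁, det_one, one_mul] at hG
  refine .of_similar (.refl Unit) hs ?_
  obtain _ | s := s
  · exact absurd (by linear_combination (by simpa using hG : (1 : F) = -1)) h2
  by_cases h : IsNonscalar G₂
  · obtain ⟨X, Y₂, y, Y, hXY, hX, hY, hY₂⟩ := exists_factorization_of_det_eq_neg_one h hG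
    exact hasNegExtension_of_factorization h2 hXY hX hY hY₂ hL
  simp only [IsNonscalar, not_forall, not_not] at h
  obtain ⟨g, rfl⟩ := h
  replace hG : g ^ (s + 1) = -1 := by simpa using hG
  have hg1 : g ≠ 1 := by
    rintro rfl
    exact h2 (by linear_combination (by simpa using hG : (1 : F) = -1))
  exact .of_similar (Equiv.emptySum Empty Unit).symm (similar_fromBlocks_smul_one hg1 H)
    (HasNegExtension.fromBlocks .one (hasNegExtension_smul_one_of_pow_eq_neg_one h2 hG))

theorem HasNegExtension.isProdThree {A : Matrix n n F} (h : HasNegExtension d (-A)) {k : ℕ}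
    (j : ℕ) (hk : k = Fintype.card n + Fintype.card d + 2 * j) :
    IsProdThree (Matrix.fromBlocks A 0 0 (-(1 : Matrix (Fin k) (Fin k) F))) := by
  have e : Fin k ≃ Fin j ⊕ ((d ⊕ Empty) ⊕ (n ⊕ Fin j)) :=
    Fintype.equivOfCardEq (by simp [hk]; ring)
  refine IsProdThree.of_similar
    (Q := -(Matrix.fromBlocks (-A) 0 0 (1 : Matrix (Fin k) (Fin k) F))) ?_
    (IsProdThree.of_similar (Similar.neg ?_)
      (h.fromBlocks (HasNegExtension.one (d := Empty) (n := Fin j))))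
  · simpa [fromBlocks_neg] using Similar.refl _
  · refine ((Similar.refl _).fromBlocks (similar_one e)).trans ?_
    rw [← fromBlocks_one, ← fromBlocks_one (l := d ⊕ Empty)]
    exact ((similar_fromBlocks_assoc _ _ _).symm.trans (similar_fromBlocks_comm _ _)).trans
      (similar_fromBlocks_assoc _ _ _)

theorem isProdThree_fromBlocks_neg_one (h2 : (2 : F) ≠ 0) {n k : ℕ} (hk : n ≤ k)
    {A : Matrix (Fin n) (Fin n) F} (hdet : (-1) ^ k * A.det = 1) :
    IsProdThree (Matrix.fromBlocks A 0 0 (-(1 : Matrix (Fin k) (Fin k) F))) := by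
  obtain ⟨t, rfl⟩ := Nat.exists_eq_add_of_le hk
  have hA : (-A).det = (-1) ^ t := by
    rw [det_neg, Fintype.card_fin]
    have : ((-1 : F) ^ t) * (-1) ^ t = 1 := by rw [← mul_pow]; simp
    rw [pow_add] at hdet
    linear_combination (-1 : F) ^ t * hdet - (-1) ^ n * A.det * this
  obtain ⟨j, rfl⟩ | ⟨j, rfl⟩ := t.even_or_odd
  · exact HasNegExtension.isProdThree (d := Empty)
      (hasNegExtension_of_det_eq_one h2 (by rw [hA, Even.neg_one_pow ⟨j, rfl⟩])) j
      (by simp; ring)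
  · exact HasNegExtension.isProdThree
      (hasNegExtension_of_det_eq_neg_one h2 (by rw [hA, Odd.neg_one_pow ⟨j, rfl⟩])) j
      (by simp; ring)

end NegExtension

end UnipotentProducts

/-- **Unnatural extensions, three U2-matrices (Theorem `skew3unipotent`).**
Let `F` be a field of characteristic `≠ 2`. Let `A ∈ GLₙ(F)` and let `k ≥ n` be an integer
such that `(−1)ᵏ · det A = 1`. Then `A ⊕ (−Iₖ) ∈ GL_{n+k}(F)` is a product of three
U2-matrices. -/
theorem stmt8 {F : Type*} [Field F] (hchar : ringChar F ≠ 2)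
    {n : ℕ} (A : Matrix (Fin n) (Fin n) F) (hA : IsUnit A)
    (k : ℕ) (hk : n ≤ k)
    (hdet : (-1 : F) ^ k * A.det = 1) :
    ∃ U₁ U₂ U₃ : Matrix (Fin (n + k)) (Fin (n + k)) F,
      (U₁ - 1) * (U₁ - 1) = 0 ∧ (U₂ - 1) * (U₂ - 1) = 0 ∧ (U₃ - 1) * (U₃ - 1) = 0 ∧
      Matrix.reindex finSumFinEquiv finSumFinEquiv
        (Matrix.fromBlocks A 0 0 (-(1 : Matrix (Fin k) (Fin k) F))) = U₁ * U₂ * U₃ := by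
  obtain ⟨a, b, c, ha, hb, hc, h⟩ := UnipotentProducts.IsProdThree.of_similar
    (UnipotentProducts.Similar.of_submatrix finSumFinEquiv.symm rfl)
    (UnipotentProducts.isProdThree_fromBlocks_neg_one (Ring.two_ne_zero hchar) hk hdet)
  exact ⟨1 + a, 1 + b, 1 + c, by simpa using ha, by simpa using hb, by simpa using hc, h⟩
end

section
/- Let F be a field, let α and β be distinct nonzero elements of F, let p ≥ 1 be an integer, and let ε ∈ {1, −1} satisfy (εαβ)^p = 1. Consider the block-diagonal matrix A := αI_p ⊕ βI_p ∈ GL_{2p}(F). (i) If ε = 1, then A is a product of three U2-matrices, and also a product of one U2-matrix and two involutions. (ii) If ε = −1, then A is a product of three involutions, and also a product of one involution and two U2-matrices. -/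
open Polynomial in
/-- The Dickson-type polynomial expressing `xⁿ + yⁿ` in terms of `x + y`, when `x * y = δ`. -/
theorem exists_monic_aeval_add_eq_pow_add_pow {F : Type*} [Field F] (δ : F) (n : ℕ) :
    ∃ P : F[X], P.Monic ∧ P.natDegree = n + 1 ∧
      ∀ {R : Type*} [CommRing R] [Algebra F R] (x y : R), x * y = algebraMap F R δ →
        aeval (x + y) P = x ^ (n + 1) + y ^ (n + 1) := by
  induction n using Nat.strong_induction_on with
  | _ n ih =>
    match n, ih with
    | 0, _ => exact ⟨X, monic_X, natDegree_X, fun x y _ => by simp⟩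
    | 1, _ =>
      refine ⟨X ^ 2 - C (2 * δ), monic_X_pow_sub_C _ (by norm_num), natDegree_X_pow_sub_C, ?_⟩
      intro R _ _ x y hxy
      simp only [map_sub, map_pow, aeval_X, aeval_C, map_mul, ← hxy, map_ofNat]
      ring
    | n + 2, ih =>
      obtain ⟨P, hP, hPd, hPe⟩ := ih n (by omega)
      obtain ⟨Q, hQ, hQd, hQe⟩ := ih (n + 1) (by omega)
      have hXQ : (X * Q).natDegree = n + 3 := by
        rw [natDegree_X_mul hQ.ne_zero, hQd]
      have hlt : (C δ * P).degree < (X * Q).degree := by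
        refine degree_lt_degree (lt_of_le_of_lt (natDegree_C_mul_le _ _) ?_)
        omega
      refine ⟨X * Q - C δ * P, (monic_X.mul hQ).sub_of_left hlt, ?_, ?_⟩
      · rw [natDegree_eq_of_degree_eq (degree_sub_eq_left_of_degree_lt hlt), hXQ]
      · intro R _ _ x y hxy
        simp only [map_sub, map_mul, aeval_X, aeval_C, hQe x y hxy, hPe x y hxy, ← hxy]
        ring

open Polynomial Matrix in
/-- Multiplication by the root of `X²ᵖ + 1` has, in a suitable basis, a block companion form
with constant coefficient `δ`, for every `p`-th root of unity `δ`. -/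
theorem exists_equiv_adjoinRoot_blockCompanion {F : Type*} [Field F] (p : ℕ) (hp : 1 ≤ p) (δ : F)
    (hδ : δ ^ p = 1) :
    ∃ (T : Matrix (Fin p) (Fin p) F)
      (e : (Fin p ⊕ Fin p → F) ≃ₗ[F] AdjoinRoot (X ^ (2 * p) + 1 : F[X])),
      ∀ v, e (fromBlocks 0 (-(δ • (1 : Matrix (Fin p) (Fin p) F))) 1 T *ᵥ v) =
        AdjoinRoot.root (X ^ (2 * p) + 1 : F[X]) * e v := by
  obtain ⟨n, rfl⟩ : ∃ n, p = n + 1 := ⟨p - 1, by omega⟩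
  obtain ⟨P, hP, hPd, hPe⟩ := exists_monic_aeval_add_eq_pow_add_pow δ n
  set h : F[X] := X ^ (2 * (n + 1)) + 1 with hh
  have hmonic : h.Monic := by simpa using monic_X_pow_add_C (1 : F) (n := 2 * (n + 1)) (by omega)
  have hdeg : h.natDegree = 2 * (n + 1) := by
    simpa using natDegree_X_pow_add_C (n := 2 * (n + 1)) (r := (1 : F))
  set x : AdjoinRoot h := AdjoinRoot.root h with hx
  have hx1 : x ^ (n + 1) * x ^ (n + 1) = -1 := by
    have := AdjoinRoot.aeval_eq (f := h) h
    rw [AdjoinRoot.mk_self, hh] at this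
    simp only [map_add, map_pow, aeval_X, map_one] at this
    linear_combination this
  set y : AdjoinRoot h := -(δ • x ^ (2 * n + 1)) with hy
  have hxy : x * y = algebraMap F _ δ := by
    rw [hy, Algebra.smul_def]
    linear_combination (-algebraMap F (AdjoinRoot h) δ) * hx1
  have hyn : x ^ (n + 1) + y ^ (n + 1) = 0 := by
    have h1 : x ^ (n + 1) * y ^ (n + 1) = 1 := by
      rw [← mul_pow, hxy, ← map_pow, hδ, map_one]
    linear_combination (y ^ (n + 1)) * hx1 - x ^ (n + 1) * h1
  have hroot : aeval (x + y) P = 0 := by rw [hPe x y hxy, hyn]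
  let φ : AdjoinRoot P →ₐ[F] AdjoinRoot h :=
    AdjoinRoot.liftAlgHom P (Algebra.ofId F _) (x + y) (by simpa [aeval_def] using hroot)
  have hφ : φ (AdjoinRoot.root P) = x + y := by simp [φ]
  let Φ : (AdjoinRoot P × AdjoinRoot P) →ₗ[F] AdjoinRoot h :=
    φ.toLinearMap.coprod (LinearMap.mulLeft F x ∘ₗ φ.toLinearMap)
  have hΦ : ∀ a b, Φ (a, b) = φ a + x * φ b := fun a b => by simp [Φ]
  have hcomp : ∀ a b, Φ (-(δ • b), a + AdjoinRoot.root P * b) = x * Φ (a, b) := by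
    intro a b
    rw [hΦ, hΦ, map_neg, map_smul, map_add, map_mul, hφ, Algebra.smul_def, ← hxy]
    ring
  have hsurj : Function.Surjective Φ := by
    intro r
    obtain ⟨q, rfl⟩ := AdjoinRoot.mk_surjective r
    induction q using Polynomial.induction_on with
    | C a => exact ⟨(algebraMap F _ a, 0), by rw [hΦ, map_zero, mul_zero, add_zero, φ.commutes]; rfl⟩
    | add f g hf hg =>
      obtain ⟨u, hu⟩ := hf
      obtain ⟨v, hv⟩ := hg
      exact ⟨u + v, by rw [map_add, map_add, hu, hv]⟩
    | monomial k a ih =>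
      obtain ⟨⟨u, v⟩, huv⟩ := ih
      refine ⟨_, (hcomp u v).trans ?_⟩
      rw [huv, hx, ← AdjoinRoot.mk_X, ← map_mul]
      congr 1
      ring
  let bP := (AdjoinRoot.powerBasis' hP).basis.reindex (finCongr (by simpa using hPd))
  let bh := (AdjoinRoot.powerBasis' hmonic).basis
  have := Module.Finite.of_basis bP
  have := Module.Finite.of_basis bh
  have hfin : Module.finrank F (AdjoinRoot P × AdjoinRoot P) =
      Module.finrank F (AdjoinRoot h) := by
    rw [Module.finrank_prod, Module.finrank_eq_card_basis bP, Module.finrank_eq_card_basis bh]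
    simp [hdeg]
    ring
  let E : (AdjoinRoot P × AdjoinRoot P) ≃ₗ[F] AdjoinRoot h :=
    LinearEquiv.ofBijective Φ
      ⟨(LinearMap.injective_iff_surjective_of_finrank_eq_finrank hfin).2 hsurj, hsurj⟩
  refine ⟨LinearMap.toMatrix bP bP (LinearMap.mulLeft F (AdjoinRoot.root P)),
    (LinearEquiv.sumArrowLequivProdArrow (Fin (n + 1)) (Fin (n + 1)) F F).trans
      ((bP.equivFun.symm.prodCongr bP.equivFun.symm).trans E), ?_⟩
  intro v
  obtain ⟨a, ha⟩ := bP.equivFun.surjective (v ∘ Sum.inl)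
  obtain ⟨b, hb⟩ := bP.equivFun.surjective (v ∘ Sum.inr)
  have hT : LinearMap.toMatrix bP bP (LinearMap.mulLeft F (AdjoinRoot.root P)) *ᵥ
      (v ∘ Sum.inr) = bP.equivFun (AdjoinRoot.root P * b) := by
    rw [← hb]
    exact LinearMap.toMatrix_mulVec_repr bP bP _ b
  have key : ∀ w : Fin (n + 1) ⊕ Fin (n + 1) → F, ∀ c d, bP.equivFun c = w ∘ Sum.inl →
      bP.equivFun d = w ∘ Sum.inr →
      ((LinearEquiv.sumArrowLequivProdArrow (Fin (n + 1)) (Fin (n + 1)) F F).trans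
      ((bP.equivFun.symm.prodCongr bP.equivFun.symm).trans E)) w = Φ (c, d) := by
    intro w c d hc hd
    have : LinearEquiv.sumArrowLequivProdArrow (Fin (n + 1)) (Fin (n + 1)) F F w =
        (bP.equivFun c, bP.equivFun d) := by
      rw [hc, hd]; rfl
    rw [LinearEquiv.trans_apply, this]
    simp only [LinearEquiv.trans_apply, LinearEquiv.prodCongr_apply,
      LinearEquiv.symm_apply_apply]
    rfl
  rw [key v a b ha hb, ← hcomp]
  apply key
  · rw [fromBlocks_mulVec, map_neg, map_smul, hb]
    ext i
    simp [Matrix.neg_mulVec, Matrix.smul_mulVec]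
  · rw [fromBlocks_mulVec, map_add, ha, ← hT]
    ext i
    simp

open Matrix in
/-- The block companion matrices of `X² - TX + δ` and `X² - T'X + 1` are similar for suitable `T`
and `T'`, when `δ` is a `p`-th root of unity. -/
theorem exists_conj_blockCompanion {F : Type*} [Field F] (p : ℕ) (hp : 1 ≤ p) (δ : F)
    (hδ : δ ^ p = 1) :
    ∃ (T T' : Matrix (Fin p) (Fin p) F) (P Q : Matrix (Fin p ⊕ Fin p) (Fin p ⊕ Fin p) F),
      Q * P = 1 ∧
      fromBlocks 0 (-(δ • (1 : Matrix (Fin p) (Fin p) F))) 1 T =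
        P * fromBlocks 0 (-1) 1 T' * Q := by
  obtain ⟨T, e, he⟩ := exists_equiv_adjoinRoot_blockCompanion p hp δ hδ
  obtain ⟨T', e', he'⟩ := exists_equiv_adjoinRoot_blockCompanion p hp (1 : F) (one_pow p)
  refine ⟨T, T', LinearMap.toMatrix' (e'.trans e.symm).toLinearMap,
    LinearMap.toMatrix' (e.trans e'.symm).toLinearMap, ?_, ?_⟩
  · rw [← LinearMap.toMatrix'_comp, ← LinearMap.toMatrix'_id]
    congr 1
    ext : 2
    simp
  · refine Matrix.toLin'.injective (LinearMap.ext fun v => ?_)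
    rw [toLin'_apply, toLin'_apply]
    apply e.injective
    rw [he, ← mulVec_mulVec, ← mulVec_mulVec, LinearMap.toMatrix'_mulVec,
      LinearMap.toMatrix'_mulVec]
    have := he' (e'.symm (e v))
    rw [one_smul] at this
    simp [this]

theorem conj_sub_one_mul_self {R : Type*} [Ring R] {P Q U : R} (h : Q * P = 1) (h' : P * Q = 1)
    (hU : (U - 1) * (U - 1) = 0) : (P * U * Q - 1) * (P * U * Q - 1) = 0 := by
  have : P * U * Q - 1 = P * (U - 1) * Q := by rw [mul_sub, sub_mul, mul_one, h']
  calc _ = P * (U - 1) * (Q * P) * (U - 1) * Q := by rw [this]; noncomm_ring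
    _ = P * ((U - 1) * (U - 1)) * Q := by rw [h]; noncomm_ring
    _ = 0 := by rw [hU]; simp

theorem conj_mul_self {R : Type*} [Ring R] {P Q U : R} (h : Q * P = 1) (h' : P * Q = 1)
    (hU : U * U = 1) : (P * U * Q) * (P * U * Q) = 1 := by
  calc _ = P * U * (Q * P) * U * Q := by noncomm_ring
    _ = P * (U * U) * Q := by rw [h]; noncomm_ring
    _ = 1 := by rw [hU, mul_one, h']

open Matrix in
/-- `αI ⊕ βI` is a conjugate of a block companion matrix times a quadratic factor. -/
theorem exists_fromBlocks_smul_one_eq_conj_mul {n F : Type*} [Fintype n] [DecidableEq n] [Field F]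
    {α β ε : F} (hne : α ≠ β) (hε : ε * ε = 1) (T : Matrix n n F) :
    ∃ G G' K : Matrix (n ⊕ n) (n ⊕ n) F, G' * G = 1 ∧
      fromBlocks (α • (1 : Matrix n n F)) 0 0 (β • 1) =
        G * fromBlocks 0 (-((ε * α * β) • (1 : Matrix n n F))) 1 T * G' * K ∧
      (ε = 1 → (K - 1) * (K - 1) = 0) ∧ (ε = -1 → K * K = 1) := by
  have hd : α - β ≠ 0 := sub_ne_zero.2 hne
  set c := (α - β)⁻¹ with hc
  have hcα : c * α = 1 + c * β := by
    have : c * (α - β) = 1 := inv_mul_cancel₀ hd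
    linear_combination this
  set Y : Matrix n n F := T - α • 1 - (ε * β) • 1 with hY
  let C : Matrix (n ⊕ n) (n ⊕ n) F := fromBlocks 1 (c • 1) 0 1
  let C' : Matrix (n ⊕ n) (n ⊕ n) F := fromBlocks 1 (-(c • 1)) 0 1
  let H : Matrix (n ⊕ n) (n ⊕ n) F := fromBlocks 0 (ε • 1) 1 ((ε * β) • 1)
  let H' : Matrix (n ⊕ n) (n ⊕ n) F := fromBlocks (-(β • 1)) 1 (ε • 1) 0
  let L : Matrix (n ⊕ n) (n ⊕ n) F := fromBlocks 1 0 (-(ε • Y)) (ε • 1)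
  have hCC : C * C' = 1 := by simp [C, C', fromBlocks_multiply]
  have hCC' : C' * C = 1 := by simp [C, C', fromBlocks_multiply]
  have hHH : H' * H = 1 := by
    simp [H, H', fromBlocks_multiply, smul_smul, hε]
  refine ⟨C * H, H' * C', C * L * C', ?_, ?_, ?_, ?_⟩
  · calc H' * C' * (C * H) = H' * (C' * C) * H := by noncomm_ring
      _ = 1 := by rw [hCC', mul_one, hHH]
  · have key : H * fromBlocks 0 (-((ε * α * β) • (1 : Matrix n n F))) 1 T * H' * L =
        fromBlocks (α • 1) 1 0 (β • 1) := by
      have h1 : H * fromBlocks 0 (-((ε * α * β) • (1 : Matrix n n F))) 1 T * H' =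
          fromBlocks (α • 1 + Y) (ε • 1) (β • Y) ((ε * β) • 1) := by
        simp only [H, H', fromBlocks_multiply, fromBlocks_inj, hY]
        simp only [mul_one, one_mul, mul_zero, add_zero, zero_add, smul_mul_assoc,
          mul_smul_comm, mul_neg]
        refine ⟨?_, trivial, ?_, trivial⟩ <;> match_scalars <;> grind
      rw [h1]
      simp only [L, fromBlocks_multiply, fromBlocks_inj]
      simp only [mul_one, one_mul, mul_zero, zero_add, smul_mul_assoc, mul_smul_comm, mul_neg]
      clear_value Y
      refine ⟨?_, ?_, ?_, ?_⟩ <;> match_scalars <;> grind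
    calc _ = C * fromBlocks (α • 1) 1 0 (β • 1) * C' := by
          simp only [C, C', fromBlocks_multiply]
          simp only [mul_one, mul_zero, add_zero, zero_add, mul_smul_comm, mul_neg,
            smul_zero, neg_zero, fromBlocks_inj]
          refine ⟨trivial, ?_, trivial, trivial⟩
          match_scalars
          linear_combination hcα
      _ = C * (H * fromBlocks 0 (-((ε * α * β) • (1 : Matrix n n F))) 1 T * H' * L) * C' := by
          rw [key]
      _ = C * H * fromBlocks 0 (-((ε * α * β) • (1 : Matrix n n F))) 1 T * (H' * (C' * C) * L * C')
          := by rw [hCC']; noncomm_ring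
      _ = _ := by noncomm_ring
  · rintro rfl
    refine conj_sub_one_mul_self hCC' hCC ?_
    have : L - 1 = fromBlocks 0 0 (-Y) 0 := by
      rw [← fromBlocks_one, sub_eq_add_neg, fromBlocks_neg, fromBlocks_add]; simp
    rw [this]; simp [fromBlocks_multiply]
  · rintro rfl
    refine conj_mul_self hCC' hCC ?_
    simp [L, fromBlocks_multiply]

open Matrix in
theorem blockCompanion_eq_mul_involutions {n F : Type*} [Fintype n] [DecidableEq n] [Field F]
    (T : Matrix n n F) :
    ∃ X Y : Matrix (n ⊕ n) (n ⊕ n) F, X * X = 1 ∧ Y * Y = 1 ∧ fromBlocks 0 (-1) 1 T = X * Y :=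
  ⟨fromBlocks 0 1 1 0, fromBlocks 1 T 0 (-1), by simp [fromBlocks_multiply],
    by simp [fromBlocks_multiply], by simp [fromBlocks_multiply]⟩

open Matrix in
theorem blockCompanion_eq_mul_unipotents {n F : Type*} [Fintype n] [DecidableEq n] [Field F]
    (T : Matrix n n F) :
    ∃ X Y : Matrix (n ⊕ n) (n ⊕ n) F, (X - 1) * (X - 1) = 0 ∧ (Y - 1) * (Y - 1) = 0 ∧
      fromBlocks 0 (-1) 1 T = X * Y := by
  refine ⟨fromBlocks 0 (-1) 1 2, fromBlocks 1 (T - 2) 0 1, ?_, ?_, ?_⟩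
  · have h2 : (2 : Matrix n n F) - 1 = 1 := by norm_num
    rw [← fromBlocks_one, sub_eq_add_neg, fromBlocks_neg, fromBlocks_add]
    simp [← sub_eq_add_neg, h2, fromBlocks_multiply]
  · rw [← fromBlocks_one, sub_eq_add_neg, fromBlocks_neg, fromBlocks_add]
    simp [fromBlocks_multiply]
  · simp [fromBlocks_multiply]

/-- **Lemma `superdiagonalLemma`.**
Let `α ≠ β` be nonzero scalars, `p ≥ 1`, and `ε ∈ {1, −1}` with `(εαβ)ᵖ = 1`. Let
`A := α Iₚ ⊕ β Iₚ ∈ GL₂ₚ(F)`.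
(i) If `ε = 1` then `A` is a product of three U2-matrices, and also of one U2-matrix and two
involutions (in some order).
(ii) If `ε = −1` then `A` is a product of three involutions, and also of one involution and
two U2-matrices (in some order). -/
theorem stmt18 {F : Type*} [Field F] (α β : F) (hα : α ≠ 0) (hβ : β ≠ 0) (hne : α ≠ β)
    (p : ℕ) (hp : 1 ≤ p) (ε : F) (hε : ε = 1 ∨ ε = -1)
    (h : (ε * α * β) ^ p = 1)
    (A : Matrix (Fin (p + p)) (Fin (p + p)) F)
    (hA : A = Matrix.reindex finSumFinEquiv finSumFinEquiv
      (Matrix.fromBlocks (α • (1 : Matrix (Fin p) (Fin p) F)) 0 0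
        (β • (1 : Matrix (Fin p) (Fin p) F)))) :
    (ε = 1 →
      (∃ U₁ U₂ U₃ : Matrix (Fin (p + p)) (Fin (p + p)) F,
          (U₁ - 1) * (U₁ - 1) = 0 ∧ (U₂ - 1) * (U₂ - 1) = 0 ∧ (U₃ - 1) * (U₃ - 1) = 0 ∧
          A = U₁ * U₂ * U₃) ∧
      (∃ (B : Fin 3 → Matrix (Fin (p + p)) (Fin (p + p)) F) (k : Fin 3),
          (B k - 1) * (B k - 1) = 0 ∧ (∀ j, j ≠ k → B j * B j = 1) ∧
          A = B 0 * B 1 * B 2)) ∧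
    (ε = -1 →
      (∃ S₁ S₂ S₃ : Matrix (Fin (p + p)) (Fin (p + p)) F,
          S₁ * S₁ = 1 ∧ S₂ * S₂ = 1 ∧ S₃ * S₃ = 1 ∧
          A = S₁ * S₂ * S₃) ∧
      (∃ (B : Fin 3 → Matrix (Fin (p + p)) (Fin (p + p)) F) (k : Fin 3),
          B k * B k = 1 ∧ (∀ j, j ≠ k → (B j - 1) * (B j - 1) = 0) ∧
          A = B 0 * B 1 * B 2)) := by
  have hε2 : ε * ε = 1 := by rcases hε with rfl | rfl <;> ring
  obtain ⟨T, T', P, Q, hQP, hT⟩ := exists_conj_blockCompanion p hp (ε * α * β) h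
  obtain ⟨G, G', K, hG, hD, hK, hK'⟩ := exists_fromBlocks_smul_one_eq_conj_mul hne hε2 T
  let f := Matrix.reindexAlgEquiv F F (finSumFinEquiv (m := p) (n := p))
  have hAf : A = f (Matrix.fromBlocks (α • 1) 0 0 (β • 1)) := hA
  have hinv : f (Q * G') * f (G * P) = 1 := by
    rw [← map_mul, ← mul_assoc, mul_assoc Q, hG, mul_one, hQP, map_one]
  have hinv' : f (G * P) * f (Q * G') = 1 := mul_eq_one_comm.1 hinv
  have hfac : ∀ X Y, Matrix.fromBlocks 0 (-1) 1 T' = X * Y →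
      A = (f (G * P) * f X * f (Q * G')) * (f (G * P) * f Y * f (Q * G')) * f K := by
    intro X Y hXY
    calc A = f (G * P) * f X * f Y * f (Q * G') * f K := by
          rw [hAf, hD, hT, hXY]
          simp only [← map_mul, mul_assoc]
      _ = f (G * P) * f X * (f (Q * G') * f (G * P)) * f Y * f (Q * G') * f K := by
          rw [hinv, mul_one]
      _ = _ := by simp only [mul_assoc]
  obtain ⟨X, Y, hX, hY, hXY⟩ := blockCompanion_eq_mul_involutions T'
  obtain ⟨U, V, hU, hV, hUV⟩ := blockCompanion_eq_mul_unipotents T'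
  have hX' := conj_mul_self hinv hinv' (U := f X) (by rw [← map_mul, hX, map_one])
  have hY' := conj_mul_self hinv hinv' (U := f Y) (by rw [← map_mul, hY, map_one])
  have hf : ∀ Z, (Z - 1) * (Z - 1) = 0 → (f Z - 1) * (f Z - 1) = 0 := by
    intro Z hZ
    rw [← map_one f, ← map_sub, ← map_mul, hZ, map_zero]
  have hU' := conj_sub_one_mul_self hinv hinv' (hf U hU)
  have hV' := conj_sub_one_mul_self hinv hinv' (hf V hV)
  refine ⟨fun h1 => ⟨⟨_, _, _, hU', hV', hf K (hK h1), hfac U V hUV⟩,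
    ⟨![_, _, f K], 2, hf K (hK h1), ?_, hfac X Y hXY⟩⟩,
    fun h1 => ?_⟩
  · intro j hj
    fin_cases j
    · exact hX'
    · exact hY'
    · exact absurd rfl hj
  · have hfK : f K * f K = 1 := by rw [← map_mul, hK' h1, map_one]
    refine ⟨⟨_, _, _, hX', hY', hfK, hfac X Y hXY⟩,
      ⟨![_, _, f K], 2, hfK, ?_, hfac U V hUV⟩⟩
    intro j hj
    fin_cases j
    · exact hU'
    · exact hV'
    · exact absurd rfl hj
end
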